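/- Let E : ℬ(ℝ) → L(H) be a normalized positive operator measure (E(ℝ) = I) such that the restriction of L(x,E) to D²(x,E) is selfadjoint (hence L(x,E) itself is selfadjoint with domain D²(x,E)). Then the following are equivalent: (i) E is a spectral measure, i.e., E(A ∩ B) = E(A)E(B) for all Borel sets A, B; (ii) L(x²,E) = L(x,E)² as operators (equal domains and values); (iii) ∫ x² dE_{φ,φ} = ‖L(x,E)φ‖² for all φ ∈ D²(x,E). -/

import Mathlib

open MeasureTheory Filter Topology ComplexConjugate
open scoped ENNReal NNReal

noncomputable section

local notation "⟪" x ", " y "⟫" => @inner ℂ _ _ x y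

/-- The total variation measure of a complex measure. -/
def MeasureTheory.ComplexMeasure.tv {Ω : Type*} [MeasurableSpace Ω]
    (ν : MeasureTheory.ComplexMeasure Ω) : MeasureTheory.Measure Ω :=
  (MeasureTheory.ComplexMeasure.re ν).totalVariation +
    (MeasureTheory.ComplexMeasure.im ν).totalVariation

/-- `f` is integrable with respect to the complex measure `ν`: it is integrable with respect
to the total variation measure of `ν`. -/
def MeasureTheory.ComplexMeasure.CIntegrable {Ω : Type*} [MeasurableSpace Ω]
    (ν : MeasureTheory.ComplexMeasure Ω) (f : Ω → ℂ) : Prop :=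
  MeasureTheory.Integrable f ν.tv

/-- The integral of a complex function against a signed measure. -/
def MeasureTheory.SignedMeasure.cintegral {Ω : Type*} [MeasurableSpace Ω]
    (σ : MeasureTheory.SignedMeasure Ω) (f : Ω → ℂ) : ℂ :=
  (∫ x, f x ∂σ.toJordanDecomposition.posPart) - ∫ x, f x ∂σ.toJordanDecomposition.negPart

/-- The integral of a complex function against a complex measure. -/
def MeasureTheory.ComplexMeasure.cintegral {Ω : Type*} [MeasurableSpace Ω]
    (ν : MeasureTheory.ComplexMeasure Ω) (f : Ω → ℂ) : ℂ :=
  (MeasureTheory.ComplexMeasure.re ν).cintegral f +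
    Complex.I * (MeasureTheory.ComplexMeasure.im ν).cintegral f

namespace MeasureTheory.SignedMeasure

variable {Ω : Type*} [MeasurableSpace Ω]

theorem exists_pos_neg_apply (σ : SignedMeasure Ω) :
    ∃ P : Set Ω, MeasurableSet P ∧ ∀ B : Set Ω, MeasurableSet B →
      σ.toJordanDecomposition.posPart.real B = σ (P ∩ B) ∧
        σ.toJordanDecomposition.negPart.real B = -σ (Pᶜ ∩ B) := by
  obtain ⟨i, hi, h1, h2, hp, hn⟩ := σ.toJordanDecomposition_spec
  refine ⟨i, hi, fun B hB => ⟨?_, ?_⟩⟩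
  · rw [hp, toMeasureOfZeroLE_real_apply σ h1 hi hB]
  · rw [hn, measureReal_def, toMeasureOfLEZero_apply σ h2 hi.compl hB]
    simp

theorem mul_totalVariation_le (σ : SignedMeasure Ω) (m : Measure Ω) [IsFiniteMeasure m]
    (c : ℝ≥0) (h : ∀ B : Set Ω, MeasurableSet B → c * |σ B| ≤ m.real B) {B : Set Ω}
    (hB : MeasurableSet B) : c * σ.totalVariation B ≤ m B := by
  obtain ⟨P, hP, hPB⟩ := σ.exists_pos_neg_apply
  have : IsFiniteMeasure σ.totalVariation := by
    unfold totalVariation; infer_instance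
  have key : c * σ.totalVariation.real B ≤ m.real B := by
    unfold totalVariation
    rw [measureReal_add_apply, (hPB B hB).1, (hPB B hB).2]
    have h1 := h _ (hP.inter hB)
    have h2 := h _ (hP.compl.inter hB)
    have h3 : m.real (P ∩ B) + m.real (Pᶜ ∩ B) = m.real B := by
      have := measureReal_inter_add_sdiff (μ := m) (s := B) hP
      rwa [Set.inter_comm, Set.sdiff_eq, Set.inter_comm B Pᶜ] at this
    have h4 := le_abs_self (σ (P ∩ B))
    have h5 := neg_le_abs (σ (Pᶜ ∩ B))
    have hc : (0 : ℝ) ≤ c := c.2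
    nlinarith [mul_le_mul_of_nonneg_left h4 hc, mul_le_mul_of_nonneg_left h5 hc]
  have h6 := ENNReal.ofReal_le_ofReal key
  rwa [ENNReal.ofReal_mul (p := (c : ℝ)) c.2, ofReal_measureReal, ofReal_measureReal,
    ENNReal.ofReal_coe_nnreal] at h6

theorem cintegral_simpleFunc (σ : SignedMeasure Ω) (s : SimpleFunc Ω ℝ) :
    σ.cintegral (fun t => (s t : ℂ)) = ∑ c ∈ s.range, (σ (s ⁻¹' {c}) : ℂ) * c := by
  unfold cintegral
  simp only [integral_complex_ofReal]
  rw [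
    s.integral_eq_sum (s.integrable_of_isFiniteMeasure),
    s.integral_eq_sum (s.integrable_of_isFiniteMeasure), Complex.ofReal_sum,
    Complex.ofReal_sum, ← Finset.sum_sub_distrib]
  refine Finset.sum_congr rfl fun c _ => ?_
  rw [apply_eq_posPart_real_sub_negPart_real σ (s.measurableSet_fiber c)]
  push_cast [smul_eq_mul]
  ring

theorem tendsto_cintegral (σ : SignedMeasure Ω) {F : ℕ → Ω → ℂ} {f : Ω → ℂ} {g : Ω → ℝ}
    (hF : ∀ n, Measurable (F n)) (hg : Integrable g σ.totalVariation)
    (hFg : ∀ n t, ‖F n t‖ ≤ g t) (hlim : ∀ t, Tendsto (fun n => F n t) atTop (𝓝 (f t))) :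
    Tendsto (fun n => σ.cintegral (F n)) atTop (𝓝 (σ.cintegral f)) := by
  unfold totalVariation at hg
  rw [integrable_add_measure] at hg
  refine Tendsto.sub ?_ ?_
  · exact tendsto_integral_of_dominated_convergence g (fun n => (hF n).aestronglyMeasurable)
      hg.1 (fun n => ae_of_all _ (hFg n)) (ae_of_all _ hlim)
  · exact tendsto_integral_of_dominated_convergence g (fun n => (hF n).aestronglyMeasurable)
      hg.2 (fun n => ae_of_all _ (hFg n)) (ae_of_all _ hlim)

theorem toJordanDecomposition_toSignedMeasure_measure (m : Measure Ω) [IsFiniteMeasure m] :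
    m.toSignedMeasure.toJordanDecomposition =
      JordanDecomposition.mk m 0 Measure.MutuallySingular.zero_right := by
  apply toJordanDecomposition_eq
  simp [JordanDecomposition.toSignedMeasure]

end MeasureTheory.SignedMeasure

namespace MeasureTheory.ComplexMeasure

variable {Ω : Type*} [MeasurableSpace Ω]

instance (ν : ComplexMeasure Ω) : IsFiniteMeasure ν.tv := by
  unfold tv SignedMeasure.totalVariation; infer_instance

theorem re_apply' (ν : ComplexMeasure Ω) (B : Set Ω) : re ν B = (ν B).re := rfl

theorem im_apply' (ν : ComplexMeasure Ω) (B : Set Ω) : im ν B = (ν B).im := rfl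

theorem cintegral_simpleFunc (ν : ComplexMeasure Ω) (s : SimpleFunc Ω ℝ) :
    ν.cintegral (fun t => (s t : ℂ)) = ∑ c ∈ s.range, ν (s ⁻¹' {c}) * c := by
  unfold cintegral
  rw [SignedMeasure.cintegral_simpleFunc, SignedMeasure.cintegral_simpleFunc, Finset.mul_sum,
    ← Finset.sum_add_distrib]
  refine Finset.sum_congr rfl fun c _ => ?_
  rw [re_apply', im_apply']
  conv_rhs => rw [← Complex.re_add_im (ν (s ⁻¹' {c}))]
  ring

theorem tendsto_cintegral (ν : ComplexMeasure Ω) {F : ℕ → Ω → ℂ} {f : Ω → ℂ} {g : Ω → ℝ}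
    (hF : ∀ n, Measurable (F n)) (hg : Integrable g ν.tv)
    (hFg : ∀ n t, ‖F n t‖ ≤ g t) (hlim : ∀ t, Tendsto (fun n => F n t) atTop (𝓝 (f t))) :
    Tendsto (fun n => ν.cintegral (F n)) atTop (𝓝 (ν.cintegral f)) := by
  unfold tv at hg
  rw [integrable_add_measure] at hg
  exact (SignedMeasure.tendsto_cintegral _ hF hg.1 hFg hlim).add
    ((SignedMeasure.tendsto_cintegral _ hF hg.2 hFg hlim).const_mul _)

theorem mul_tv_le (ν : ComplexMeasure Ω) (m : Measure Ω) [IsFiniteMeasure m]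
    (c : ℝ≥0) (hre : ∀ B : Set Ω, MeasurableSet B → c * |(ν B).re| ≤ m.real B)
    (him : ∀ B : Set Ω, MeasurableSet B → c * |(ν B).im| ≤ m.real B) {B : Set Ω}
    (hB : MeasurableSet B) : c * ν.tv B ≤ 2 * m B := by
  unfold tv
  rw [Measure.add_apply, mul_add, two_mul]
  exact add_le_add (SignedMeasure.mul_totalVariation_le _ m c hre hB)
    (SignedMeasure.mul_totalVariation_le _ m c him hB)

/-- A complex measure with nonnegative values is the coercion of a finite measure, its total
variation. -/
theorem exists_measure_of_nonneg (ν : ComplexMeasure Ω)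
    (h : ∀ B : Set Ω, MeasurableSet B → 0 ≤ (ν B).re ∧ (ν B).im = 0) :
    re ν = ν.tv.toSignedMeasure ∧ im ν = 0 := by
  have him : im ν = 0 := by
    ext B hB
    rw [im_apply']
    exact (h B hB).2
  have hre : 0 ≤[Set.univ] re ν := by
    rw [VectorMeasure.restrict_univ, VectorMeasure.restrict_univ]
    intro B hB
    exact (h B hB).1
  have h1 := SignedMeasure.toMeasureOfZeroLE_toSignedMeasure (re ν) hre
  refine ⟨?_, him⟩
  have h2 : ν.tv = SignedMeasure.toMeasureOfZeroLE (re ν) Set.univ MeasurableSet.univ hre := by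
    unfold tv
    rw [him, SignedMeasure.totalVariation_zero, add_zero]
    conv_lhs => rw [← h1]
    rw [SignedMeasure.totalVariation, SignedMeasure.toJordanDecomposition_toSignedMeasure_measure]
    simp
  simp_rw [h2]
  exact h1.symm

theorem tv_real_of_nonneg (ν : ComplexMeasure Ω)
    (h : ∀ B : Set Ω, MeasurableSet B → 0 ≤ (ν B).re ∧ (ν B).im = 0) {B : Set Ω}
    (hB : MeasurableSet B) :
    (ν.tv.real B : ℂ) = ν B := by
  obtain ⟨h1, h2⟩ := ν.exists_measure_of_nonneg h
  have h3 : re ν B = ν.tv.real B := by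
    rw [h1, Measure.toSignedMeasure_apply_measurable hB]
  rw [← h3, re_apply']
  exact Complex.ext rfl (by simp [(h B hB).2])

theorem cintegral_of_nonneg (ν : ComplexMeasure Ω)
    (h : ∀ B : Set Ω, MeasurableSet B → 0 ≤ (ν B).re ∧ (ν B).im = 0) (f : Ω → ℂ) :
    ν.cintegral f = ∫ t, f t ∂ν.tv := by
  obtain ⟨h1, h2⟩ := ν.exists_measure_of_nonneg h
  unfold cintegral
  rw [h2, h1]
  simp [SignedMeasure.cintegral, SignedMeasure.toJordanDecomposition_toSignedMeasure_measure,
    SignedMeasure.toJordanDecomposition_zero]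

end MeasureTheory.ComplexMeasure

section PositiveOperatorMeasure

variable {Ω : Type*} [MeasurableSpace Ω]
  {H : Type*} [NormedAddCommGroup H] [InnerProductSpace ℂ H]

/-- `E` is a normalized positive operator measure, with matrix elements `ν`. -/
structure IsNormalizedPOM (E : Set Ω → H →L[ℂ] H) (ν : H → H → ComplexMeasure Ω) : Prop where
  pos : ∀ B : Set Ω, MeasurableSet B → (E B).IsPositive
  one : E Set.univ = 1
  apply : ∀ (ψ φ : H) (B : Set Ω), MeasurableSet B → ν ψ φ B = ⟪ψ, E B φ⟫

/-- The integral of a simple function with respect to an operator valued set function. -/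
def simpleIntegral (E : Set Ω → H →L[ℂ] H) (s : SimpleFunc Ω ℝ) : H →L[ℂ] H :=
  ∑ c ∈ s.range, (c : ℂ) • E (s ⁻¹' {c})

theorem IsPositive.norm_sum_sq_le {ι : Type*} (t : Finset ι) (P : ι → H →L[ℂ] H)
    (hP : ∀ i ∈ t, (P i).IsPositive) (hsum : ∑ i ∈ t, P i = 1) (w : ι → H) :
    ‖∑ i ∈ t, P i (w i)‖ ^ 2 ≤ ∑ i ∈ t, (⟪w i, P i (w i)⟫).re := by
  set η := ∑ i ∈ t, P i (w i) with hη
  have h0 : 0 ≤ ∑ i ∈ t, (⟪w i - η, P i (w i - η)⟫).re :=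
    Finset.sum_nonneg fun i hi => (hP i hi).re_inner_nonneg_right _
  have h1 : ∀ i ∈ t, (⟪w i - η, P i (w i - η)⟫).re =
      (⟪w i, P i (w i)⟫).re - 2 * (⟪η, P i (w i)⟫).re + (⟪η, P i η⟫).re := by
    intro i hi
    have h2 : (⟪w i, P i η⟫).re = (⟪η, P i (w i)⟫).re := by
      rw [← (hP i hi).inner_left_eq_inner_right, ← inner_conj_symm, Complex.conj_re]
    simp only [map_sub, inner_sub_left, inner_sub_right, Complex.sub_re, h2]
    ring
  have h3 : ∑ i ∈ t, (⟪η, P i (w i)⟫).re = ‖η‖ ^ 2 := by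
    rw [← Complex.re_sum, ← inner_sum, ← hη, ← inner_self_eq_norm_sq (𝕜 := ℂ)]; rfl
  have h4 : ∑ i ∈ t, (⟪η, P i η⟫).re = ‖η‖ ^ 2 := by
    rw [← Complex.re_sum, ← inner_sum, ← _root_.sum_apply, hsum,
      ← inner_self_eq_norm_sq (𝕜 := ℂ)]; rfl
  rw [Finset.sum_congr rfl h1, Finset.sum_add_distrib, Finset.sum_sub_distrib, ← Finset.mul_sum,
    h3, h4] at h0
  linarith

theorem IsPositive.norm_sum_smul_sub_sq_le {ι : Type*} (t : Finset ι) (P : ι → H →L[ℂ] H)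
    (hP : ∀ i ∈ t, (P i).IsPositive) (hsum : ∑ i ∈ t, P i = 1) (a b : ι → ℝ)
    (hb : ∀ i ∈ t, b i ^ 2 ≤ 1) (φ ψ : H) :
    ‖(∑ i ∈ t, ((a i * b i : ℝ) : ℂ) • P i) φ - (∑ i ∈ t, (b i : ℂ) • P i) ψ‖ ^ 2 ≤
      (⟪φ, (∑ i ∈ t, ((a i ^ 2 : ℝ) : ℂ) • P i) φ⟫).re -
        2 * (⟪ψ, (∑ i ∈ t, (a i : ℂ) • P i) φ⟫).re + ‖ψ‖ ^ 2 := by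
  have key := IsPositive.norm_sum_sq_le t P hP hsum fun i => (b i : ℂ) • ((a i : ℂ) • φ - ψ)
  have e1 : ∑ i ∈ t, P i ((b i : ℂ) • ((a i : ℂ) • φ - ψ)) =
      (∑ i ∈ t, ((a i * b i : ℝ) : ℂ) • P i) φ - (∑ i ∈ t, (b i : ℂ) • P i) ψ := by
    rw [_root_.sum_apply, _root_.sum_apply, ← Finset.sum_sub_distrib]
    refine Finset.sum_congr rfl fun i _ => ?_
    rw [map_smul, map_sub, map_smul, smul_sub, smul_smul, _root_.smul_apply, _root_.smul_apply,
      Complex.ofReal_mul, mul_comm (b i : ℂ)]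
  rw [e1] at key
  refine key.trans ?_
  have e2 : ∀ i ∈ t, (⟪(b i : ℂ) • ((a i : ℂ) • φ - ψ),
      P i ((b i : ℂ) • ((a i : ℂ) • φ - ψ))⟫).re ≤
      (⟪φ, (((a i ^ 2 : ℝ) : ℂ) • P i) φ⟫).re - 2 * (⟪ψ, ((a i : ℂ) • P i) φ⟫).re +
        (⟪ψ, P i ψ⟫).re := by
    intro i hi
    have h3 : (⟪φ, P i ψ⟫).re = (⟪ψ, P i φ⟫).re := by
      rw [← (hP i hi).inner_left_eq_inner_right, ← inner_conj_symm, Complex.conj_re]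
    have h4 : (⟪(a i : ℂ) • φ - ψ, P i ((a i : ℂ) • φ - ψ)⟫).re =
        (⟪φ, (((a i ^ 2 : ℝ) : ℂ) • P i) φ⟫).re - 2 * (⟪ψ, ((a i : ℂ) • P i) φ⟫).re +
        (⟪ψ, P i ψ⟫).re := by
      simp only [map_sub, map_smul, inner_sub_left, inner_sub_right, inner_smul_left,
        inner_smul_right, Complex.conj_ofReal, _root_.smul_apply, Complex.sub_re,
        Complex.re_ofReal_mul, h3]
      ring
    rw [← h4, map_smul, inner_smul_left, inner_smul_right, Complex.conj_ofReal,
      Complex.re_ofReal_mul, Complex.re_ofReal_mul, ← mul_assoc, ← sq]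
    exact mul_le_of_le_one_left ((hP i hi).re_inner_nonneg_right _) (hb i hi)
  refine (Finset.sum_le_sum e2).trans_eq ?_
  have e4 : ‖ψ‖ ^ 2 = (⟪ψ, (∑ i ∈ t, P i) ψ⟫).re := by
    rw [hsum, ← inner_self_eq_norm_sq (𝕜 := ℂ)]; rfl
  rw [e4]
  simp only [Finset.sum_add_distrib, Finset.sum_sub_distrib, ← Finset.mul_sum,
    _root_.sum_apply, inner_sum, Complex.re_sum]

namespace IsNormalizedPOM

variable {E : Set Ω → H →L[ℂ] H} {ν : H → H → ComplexMeasure Ω} (hE : IsNormalizedPOM E ν)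
include hE

theorem diag_nonneg (φ : H) (B : Set Ω) (hB : MeasurableSet B) :
    0 ≤ (ν φ φ B).re ∧ (ν φ φ B).im = 0 := by
  rw [hE.apply _ _ _ hB]
  refine ⟨(hE.pos B hB).re_inner_nonneg_right φ, ?_⟩
  rw [← Complex.conj_eq_iff_im, inner_conj_symm]
  exact (hE.pos B hB).inner_left_eq_inner_right φ φ

theorem tv_real (φ : H) {B : Set Ω} (hB : MeasurableSet B) :
    ((ν φ φ).tv.real B : ℂ) = ⟪φ, E B φ⟫ := by
  rw [ComplexMeasure.tv_real_of_nonneg _ (hE.diag_nonneg φ) hB, hE.apply _ _ _ hB]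

theorem ext_of_inner {S : H →L[ℂ] H} {B : Set Ω} (hB : MeasurableSet B)
    (h : ∀ φ, ⟪φ, S φ⟫ = ((ν φ φ).tv.real B : ℂ)) : S = E B := by
  apply ContinuousLinearMap.coe_inj.1
  apply (ext_inner_map _ _).1
  intro φ
  rw [← inner_conj_symm, ← inner_conj_symm (_ : H) φ]
  congr 1
  exact (h φ).trans (hE.tv_real φ hB)

theorem empty : E ∅ = 0 :=
  (hE.ext_of_inner MeasurableSet.empty fun φ => by simp).symm

theorem inner_simpleIntegral (ψ φ : H) (s : SimpleFunc Ω ℝ) :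
    ⟪ψ, simpleIntegral E s φ⟫ = (ν ψ φ).cintegral fun t => (s t : ℂ) := by
  rw [ComplexMeasure.cintegral_simpleFunc, simpleIntegral, _root_.sum_apply,
    inner_sum]
  refine Finset.sum_congr rfl fun c _ => ?_
  rw [hE.apply _ _ _ (s.measurableSet_fiber c), _root_.smul_apply, inner_smul_right,
    mul_comm]

theorem inner_simpleIntegral_self (φ : H) (s : SimpleFunc Ω ℝ) :
    ⟪φ, simpleIntegral E s φ⟫ = ((∫ t, s t ∂(ν φ φ).tv : ℝ) : ℂ) := by
  rw [hE.inner_simpleIntegral, ComplexMeasure.cintegral_of_nonneg _ (hE.diag_nonneg φ),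
    integral_complex_ofReal]

theorem simpleIntegral_map {β : Type*} (g : SimpleFunc Ω β) (F : β → ℝ) :
    simpleIntegral E (g.map F) = ∑ r ∈ g.range, (F r : ℂ) • E (g ⁻¹' {r}) := by
  apply ContinuousLinearMap.coe_inj.1
  apply (ext_inner_map _ _).1
  intro φ
  rw [← inner_conj_symm, ← inner_conj_symm (_ : H) φ]
  congr 1
  have h1 : (∫ t, (g.map F) t ∂(ν φ φ).tv) = ∑ r ∈ g.range, (ν φ φ).tv.real (g ⁻¹' {r}) * F r := by
    have h2 : ∀ t, (g.map F) t = ∑ r ∈ g.range, (g ⁻¹' {r}).indicator (fun _ => F r) t := by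
      intro t
      rw [Finset.sum_eq_single_of_mem (g t) (g.mem_range_self t)]
      · simp
      · intro r _ hr
        exact Set.indicator_of_notMem (fun h => hr h.symm) _
    simp_rw [h2]
    rw [integral_finsetSum _ fun r _ =>
      (integrable_const _).indicator (g.measurableSet_fiber r)]
    refine Finset.sum_congr rfl fun r _ => ?_
    rw [integral_indicator_const _ (g.measurableSet_fiber r), smul_eq_mul]
  simp only [ContinuousLinearMap.coe_coe]
  rw [hE.inner_simpleIntegral_self, h1]
  simp only [_root_.sum_apply, inner_sum, _root_.smul_apply,
    inner_smul_right, Complex.ofReal_sum, Complex.ofReal_mul]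
  refine Finset.sum_congr rfl fun c _ => ?_
  rw [hE.tv_real _ (g.measurableSet_fiber c), mul_comm]

theorem isSymmetric_simpleIntegral (s : SimpleFunc Ω ℝ) (ψ φ : H) :
    ⟪simpleIntegral E s ψ, φ⟫ = ⟪ψ, simpleIntegral E s φ⟫ := by
  simp only [simpleIntegral, _root_.sum_apply, inner_sum, sum_inner,
    _root_.smul_apply, inner_smul_right, inner_smul_left, Complex.conj_ofReal]
  exact Finset.sum_congr rfl fun c _ => by
    rw [(hE.pos _ (s.measurableSet_fiber c)).inner_left_eq_inner_right]

theorem simpleIntegral_indicator {B : Set Ω} (hB : MeasurableSet B) :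
    simpleIntegral E (SimpleFunc.piecewise B hB (SimpleFunc.const Ω 1) (SimpleFunc.const Ω 0)) =
      E B := by
  refine hE.ext_of_inner hB fun φ => ?_
  rw [hE.inner_simpleIntegral_self]
  congr 1
  rw [← integral_indicator_one hB]
  refine integral_congr_ae (ae_of_all _ fun t => ?_)
  by_cases ht : t ∈ B <;> simp [ht]

theorem simpleIntegral_one : simpleIntegral E (SimpleFunc.const Ω 1) = 1 := by
  rw [← hE.one, ← hE.simpleIntegral_indicator MeasurableSet.univ]
  congr 1
  ext t
  simp

theorem norm_simpleIntegral_sub_sq_le (s : SimpleFunc Ω ℝ) {B : Set Ω} (hB : MeasurableSet B)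
    (φ ψ : H) :
    ‖simpleIntegral E (s * SimpleFunc.piecewise B hB (SimpleFunc.const Ω 1)
        (SimpleFunc.const Ω 0)) φ - E B ψ‖ ^ 2 ≤
      (∫ t, s t ^ 2 ∂(ν φ φ).tv) - 2 * (⟪ψ, simpleIntegral E s φ⟫).re + ‖ψ‖ ^ 2 := by
  set u := SimpleFunc.piecewise B hB (SimpleFunc.const Ω (1 : ℝ)) (SimpleFunc.const Ω 0) with hu
  set g := s.pair u
  set P : ℝ × ℝ → H →L[ℂ] H := fun r => E (g ⁻¹' {r})
  have hg : ∀ (F : ℝ × ℝ → ℝ) (v : SimpleFunc Ω ℝ), (∀ t, v t = F (s t, u t)) →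
      simpleIntegral E v = ∑ r ∈ g.range, (F r : ℂ) • P r := by
    intro F v hv
    rw [← hE.simpleIntegral_map g F]
    congr 1
    exact SimpleFunc.ext hv
  have hss : (∫ t, s t ^ 2 ∂(ν φ φ).tv) = (⟪φ, simpleIntegral E (s.map (· ^ 2)) φ⟫).re := by
    rw [hE.inner_simpleIntegral_self]; rfl
  have h1 : ∑ r ∈ g.range, P r = 1 := by
    rw [← hE.simpleIntegral_one, hg (fun _ => 1) (SimpleFunc.const Ω 1) fun t => rfl]
    simp
  rw [hss, ← hE.simpleIntegral_indicator hB, ← hu, hg (fun r => r.1 * r.2) (s * u) fun t => rfl,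
    hg (fun r => r.2) u fun t => rfl, hg (fun r => r.1) s fun t => rfl,
    hg (fun r => r.1 ^ 2) (s.map (· ^ 2)) fun t => rfl]
  refine IsPositive.norm_sum_smul_sub_sq_le _ P (fun r _ => hE.pos _ (g.measurableSet_fiber r)) h1
    (fun r => r.1) (fun r => r.2) (fun r hr => ?_) φ ψ
  obtain ⟨t, rfl⟩ := SimpleFunc.mem_range.1 hr
  by_cases ht : t ∈ B <;> simp [g, hu, ht]

theorem nnreal_mul_tv_le (ψ φ : H) (c : ℝ≥0) {B : Set Ω} (hB : MeasurableSet B) :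
    c * (ν ψ φ).tv B ≤ 2 * (c ^ 2 * (ν φ φ).tv B + (ν ψ ψ).tv B) := by
  have hm : ∀ B, MeasurableSet B → (c ^ 2 • (ν φ φ).tv + (ν ψ ψ).tv).real B =
      c ^ 2 * (⟪φ, E B φ⟫).re + (⟪ψ, E B ψ⟫).re := by
    intro B hB
    rw [measureReal_add_apply, measureReal_nnreal_smul_apply, ← hE.tv_real _ hB,
      ← hE.tv_real _ hB]
    simp
  have key : ∀ (a : ℂ), ‖a‖ = 1 → ∀ B, MeasurableSet B →
      c * (a * ν ψ φ B).re ≤ (c ^ 2 • (ν φ φ).tv + (ν ψ ψ).tv).real B := by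
    intro a ha B hB
    have hp := hE.pos B hB
    have ha' : conj a * a = 1 := by
      rw [← Complex.normSq_eq_conj_mul_self, Complex.normSq_eq_norm_sq, ha]; simp
    rw [hm B hB, hE.apply _ _ _ hB]
    have h0 := hp.re_inner_nonneg_right ((c * a : ℂ) • φ - ψ)
    have h2 : ⟪φ, E B ψ⟫ = conj ⟪ψ, E B φ⟫ := by
      rw [inner_conj_symm]; exact (hp.inner_left_eq_inner_right _ _).symm
    have h3 := hp.re_inner_nonneg_right φ
    have h4 := hp.re_inner_nonneg_right ψ
    have h5 : ⟪(c * a : ℂ) • φ - ψ, E B ((c * a : ℂ) • φ - ψ)⟫ =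
        (c ^ 2 : ℝ) * ⟪φ, E B φ⟫ + ⟪ψ, E B ψ⟫ - (c : ℝ) * (a * ⟪ψ, E B φ⟫ +
          conj (a * ⟪ψ, E B φ⟫)) := by
      simp only [map_sub, map_smul, inner_sub_left, inner_sub_right, inner_smul_left,
        inner_smul_right, h2, map_mul, Complex.conj_ofReal]
      push_cast
      linear_combination (c : ℂ) ^ 2 * ⟪φ, E B φ⟫ * ha'
    rw [h5] at h0
    rw [Complex.add_conj] at h0
    simp only [RCLike.re_eq_complex_re, Complex.sub_re, Complex.add_re, Complex.re_ofReal_mul,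
      Complex.ofReal_re] at h0 h3 h4
    nlinarith [mul_nonneg (sq_nonneg (c : ℝ)) h3]
  have h := (ν ψ φ).mul_tv_le (c ^ 2 • (ν φ φ).tv + (ν ψ ψ).tv) c (fun B hB => ?_)
    (fun B hB => ?_) hB
  · simpa [ENNReal.smul_def] using h
  · rcases abs_choice (ν ψ φ B).re with h | h <;> rw [h]
    · simpa using key 1 (by simp) B hB
    · simpa using key (-1) (by simp) B hB
  · rcases abs_choice (ν ψ φ B).im with h | h <;> rw [h]
    · simpa using key (-Complex.I) (by simp) B hB
    · simpa using key Complex.I (by simp) B hB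

theorem cintegrable_of_sq (ψ φ : H) {f : Ω → ℝ} (hf : Measurable f)
    (hi : Integrable (fun t => f t ^ 2) (ν φ φ).tv) :
    (ν ψ φ).CIntegrable fun t => (f t : ℂ) := by
  refine ⟨(Complex.measurable_ofReal.comp hf).aestronglyMeasurable, ?_⟩
  set N : Ω → ℕ := fun t => ⌈|f t|⌉₊
  have hN : Measurable N := Nat.measurable_ceil.comp hf.abs
  have hsum : ∀ (m : Measure Ω) (G : ℕ → ℝ≥0∞), ∫⁻ t, G (N t) ∂m = ∑' k, G k * m (N ⁻¹' {k}) := by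
    intro m G
    rw [← lintegral_map (measurable_of_countable G) hN, lintegral_countable']
    exact tsum_congr fun k => by rw [Measure.map_apply hN (measurableSet_singleton k)]
  have h1 : ∫⁻ t, ‖(f t : ℂ)‖ₑ ∂(ν ψ φ).tv ≤ ∫⁻ t, (N t : ℝ≥0∞) ∂(ν ψ φ).tv := by
    refine lintegral_mono fun t => ?_
    rw [← ofReal_norm, Complex.norm_real, Real.norm_eq_abs, ← ENNReal.ofReal_natCast]
    exact ENNReal.ofReal_le_ofReal (Nat.le_ceil _)
  have h2 : ∫⁻ t, (N t : ℝ≥0∞) ∂(ν ψ φ).tv ≤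
      2 * (∫⁻ t, (N t : ℝ≥0∞) ^ 2 ∂(ν φ φ).tv + ∫⁻ _, 1 ∂(ν ψ ψ).tv) := by
    rw [hsum _ fun k => (k : ℝ≥0∞), hsum _ fun k => (k : ℝ≥0∞) ^ 2, hsum _ fun _ => 1,
      ← ENNReal.tsum_add, ← ENNReal.tsum_mul_left]
    refine ENNReal.tsum_le_tsum fun k => ?_
    simpa using hE.nnreal_mul_tv_le ψ φ k (hN (measurableSet_singleton k))
  have h3 : ∫⁻ t, (N t : ℝ≥0∞) ^ 2 ∂(ν φ φ).tv < ∞ := by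
    refine lt_of_le_of_lt ?_ ((hi.const_mul 2).add (integrable_const 2)).2
    refine lintegral_mono fun t => ?_
    rw [← ENNReal.ofReal_natCast, ← ENNReal.ofReal_pow (Nat.cast_nonneg _),
      ← ofReal_norm]
    apply ENNReal.ofReal_le_ofReal
    have h4 : (N t : ℝ) ≤ |f t| + 1 := (Nat.ceil_lt_add_one (abs_nonneg _)).le
    have h5 : (0 : ℝ) ≤ N t := Nat.cast_nonneg _
    refine le_trans ?_ (le_abs_self _)
    simp only [Pi.add_apply]
    nlinarith [sq_abs (f t), sq_nonneg (|f t| - 1)]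
  refine (h1.trans h2).trans_lt (ENNReal.mul_lt_top (by simp) (ENNReal.add_lt_top.2 ⟨h3, ?_⟩))
  rw [lintegral_one]
  exact measure_lt_top _ _

theorem tendsto_simpleIntegral (ψ φ : H) {s : ℕ → SimpleFunc Ω ℝ} {f g : Ω → ℝ}
    (hg : Integrable g (ν ψ φ).tv) (hsg : ∀ n t, |s n t| ≤ g t)
    (hlim : ∀ t, Tendsto (fun n => s n t) atTop (𝓝 (f t))) :
    Tendsto (fun n => ⟪ψ, simpleIntegral E (s n) φ⟫) atTop
      (𝓝 ((ν ψ φ).cintegral fun t => (f t : ℂ))) := by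
  simp_rw [hE.inner_simpleIntegral]
  refine ComplexMeasure.tendsto_cintegral _
    (fun n => Complex.measurable_ofReal.comp (s n).measurable) hg (fun n t => ?_) fun t => ?_
  · simpa using hsg n t
  · exact (Complex.continuous_ofReal.tendsto _).comp (hlim t)

end IsNormalizedPOM

end PositiveOperatorMeasure

section FirstMoment

/-- Simple functions approximating the identity function of `ℝ`. -/
def approxId (n : ℕ) : SimpleFunc ℝ ℝ :=
  SimpleFunc.approxOn (fun t : ℝ => t) measurable_id Set.univ 0 trivial n

theorem abs_approxId_le (n : ℕ) (t : ℝ) : |approxId n t| ≤ 2 * |t| := by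
  have h := SimpleFunc.norm_approxOn_zero_le (f := fun t : ℝ => t) measurable_id
    (s := Set.univ) trivial t n
  rw [two_mul]
  exact h

theorem approxId_sq_le (n : ℕ) (t : ℝ) : approxId n t ^ 2 ≤ 4 * t ^ 2 := by
  have h := pow_le_pow_left₀ (abs_nonneg _) (abs_approxId_le n t) 2
  rwa [mul_pow, sq_abs, sq_abs, show (2 : ℝ) ^ 2 = 4 by norm_num] at h

theorem tendsto_approxId (t : ℝ) : Tendsto (fun n => approxId n t) atTop (𝓝 t) :=
  SimpleFunc.tendsto_approxOn (f := fun t : ℝ => t) measurable_id (s := Set.univ) trivial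
    (by simp)

theorem integrable_approxId_sq {μ : Measure ℝ} [IsFiniteMeasure μ] (n : ℕ) :
    Integrable (fun t => approxId n t ^ 2) μ := by
  have h := SimpleFunc.integrable_of_isFiniteMeasure (μ := μ) ((approxId n).map (· ^ 2))
  exact h

theorem tendsto_integral_approxId_sq {μ : Measure ℝ} (hμ : Integrable (fun t : ℝ => t ^ 2) μ) :
    Tendsto (fun n => ∫ t, approxId n t ^ 2 ∂μ) atTop (𝓝 (∫ t, t ^ 2 ∂μ)) := by
  refine tendsto_integral_of_dominated_convergence (fun t => 4 * t ^ 2)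
    (fun n => ((approxId n).measurable.pow_const 2).aestronglyMeasurable)
    (hμ.const_mul 4) (fun n => ae_of_all _ fun t => ?_)
    (ae_of_all _ fun t => (tendsto_approxId t).pow 2)
  rw [Real.norm_of_nonneg (sq_nonneg _)]
  exact approxId_sq_le n t

/-- A nonnegative sequence with bounded integrals has an integrable limit. -/
theorem integrable_of_tendsto_of_integral_le {Ω : Type*} [MeasurableSpace Ω] {μ : Measure Ω}
    {F : ℕ → Ω → ℝ} {f : Ω → ℝ} {C : ℝ} (hf : Measurable f) (hF : ∀ n, Integrable (F n) μ)
    (hF0 : ∀ n t, 0 ≤ F n t) (hlim : ∀ t, Tendsto (fun n => F n t) atTop (𝓝 (f t)))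
    (hC : ∀ n, ∫ t, F n t ∂μ ≤ C) : Integrable f μ ∧ ∫ t, f t ∂μ ≤ C := by
  have hf0 : ∀ t, 0 ≤ f t := fun t => ge_of_tendsto' (hlim t) fun n => hF0 n t
  have hC0 : 0 ≤ C := (integral_nonneg (hF0 0)).trans (hC 0)
  have h1 : ∫⁻ t, ENNReal.ofReal (f t) ∂μ ≤ ENNReal.ofReal C := by
    have h2 : ∀ t, ENNReal.ofReal (f t) = liminf (fun n => ENNReal.ofReal (F n t)) atTop :=
      fun t => ((ENNReal.continuous_ofReal.tendsto _).comp (hlim t)).liminf_eq.symm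
    simp_rw [h2]
    refine (lintegral_liminf_le' fun n => (hF n).1.aemeasurable.ennreal_ofReal).trans ?_
    refine liminf_le_of_frequently_le' (Frequently.of_forall fun n => ?_)
    rw [← ofReal_integral_eq_lintegral_ofReal (hF n) (ae_of_all _ (hF0 n))]
    exact ENNReal.ofReal_le_ofReal (hC n)
  have hint : Integrable f μ :=
    (lintegral_ofReal_ne_top_iff_integrable hf.aestronglyMeasurable (ae_of_all _ hf0)).1
      (h1.trans_lt ENNReal.ofReal_lt_top).ne
  refine ⟨hint, ?_⟩
  rwa [← ofReal_integral_eq_lintegral_ofReal hint (ae_of_all _ hf0),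
    ENNReal.ofReal_le_ofReal_iff hC0] at h1

variable {H : Type*} [NormedAddCommGroup H] [InnerProductSpace ℂ H]

/-- The square integrability domain of a positive operator measure with matrix elements `ν`. -/
def sqDomain (ν : H → H → ComplexMeasure ℝ) : Set H :=
  {φ | Integrable (fun t : ℝ => t ^ 2) (ν φ φ).tv}

/-- The operator `A` is the first moment `L(x,E)` of `E`, and its restriction to the square
integrability domain is selfadjoint. -/
structure IsSelfAdjointFirstMoment (E : Set ℝ → H →L[ℂ] H) (ν : H → H → ComplexMeasure ℝ)
    (A : H → H) : Prop extends IsNormalizedPOM E ν where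
  inner_moment : ∀ φ : H, (∀ ψ : H, (ν ψ φ).CIntegrable fun t => (t : ℂ)) →
    ∀ ψ : H, ⟪ψ, A φ⟫ = (ν ψ φ).cintegral fun t => (t : ℂ)
  dense : Dense (sqDomain ν)
  symm : ∀ φ ∈ sqDomain ν, ∀ χ ∈ sqDomain ν, ⟪A φ, χ⟫ = ⟪φ, A χ⟫
  adj : ∀ ψ χ : H, (∀ φ ∈ sqDomain ν, ⟪ψ, A φ⟫ = ⟪χ, φ⟫) → ψ ∈ sqDomain ν ∧ A ψ = χ

namespace IsSelfAdjointFirstMoment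

variable {E : Set ℝ → H →L[ℂ] H} {ν : H → H → ComplexMeasure ℝ} {A : H → H}
  (hE : IsSelfAdjointFirstMoment E ν A)
include hE

theorem cintegrable_of_mem {φ : H} (hφ : φ ∈ sqDomain ν) (ψ : H) :
    (ν ψ φ).CIntegrable fun t => (t : ℂ) :=
  hE.cintegrable_of_sq ψ φ measurable_id hφ

theorem tendsto_of_cintegrable {φ : H} (hφ : ∀ ψ : H, (ν ψ φ).CIntegrable fun t => (t : ℂ))
    (ψ : H) : Tendsto (fun n => ⟪ψ, simpleIntegral E (approxId n) φ⟫) atTop (𝓝 ⟪ψ, A φ⟫) := by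
  rw [hE.inner_moment φ hφ]
  refine hE.tendsto_simpleIntegral ψ φ (g := fun t => 2 * |t|) ?_ abs_approxId_le tendsto_approxId
  simpa using (Integrable.norm (hφ ψ)).const_mul 2

theorem tendsto_of_mem {φ : H} (hφ : φ ∈ sqDomain ν) (ψ : H) :
    Tendsto (fun n => ⟪ψ, simpleIntegral E (approxId n) φ⟫) atTop (𝓝 ⟪ψ, A φ⟫) :=
  hE.tendsto_of_cintegrable (hE.cintegrable_of_mem hφ) ψ

theorem mem_of_cintegrable {φ : H} (hφ : ∀ ψ : H, (ν ψ φ).CIntegrable fun t => (t : ℂ)) :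
    φ ∈ sqDomain ν := by
  refine (hE.adj φ (A φ) fun χ hχ => ?_).1
  refine tendsto_nhds_unique (hE.tendsto_of_mem hχ φ) ?_
  have h := (Complex.continuous_conj.tendsto _).comp (hE.tendsto_of_cintegrable hφ χ)
  rw [inner_conj_symm] at h
  refine h.congr fun n => ?_
  rw [Function.comp_apply, inner_conj_symm, hE.isSymmetric_simpleIntegral]

theorem cintegrable_iff {φ : H} :
    (∀ ψ : H, (ν ψ φ).CIntegrable fun t => (t : ℂ)) ↔ φ ∈ sqDomain ν :=
  ⟨hE.mem_of_cintegrable, fun h => hE.cintegrable_of_mem h⟩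

theorem add_smul_mem {φ χ : H} (hφ : φ ∈ sqDomain ν) (hχ : χ ∈ sqDomain ν) (c : ℂ) :
    φ + c • χ ∈ sqDomain ν ∧ A (φ + c • χ) = A φ + c • A χ :=
  hE.adj _ _ fun η hη => by
    rw [inner_add_left, inner_add_left, inner_smul_left, inner_smul_left, hE.symm φ hφ η hη,
      hE.symm χ hχ η hη]

theorem zero_mem : (0 : H) ∈ sqDomain ν ∧ A 0 = 0 :=
  hE.adj _ _ fun η _ => by simp

theorem smul_mem {χ : H} (hχ : χ ∈ sqDomain ν) (c : ℂ) :
    c • χ ∈ sqDomain ν ∧ A (c • χ) = c • A χ := by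
  have h := hE.add_smul_mem hE.zero_mem.1 hχ c
  rwa [hE.zero_mem.2, zero_add, zero_add] at h

theorem add_mem {φ χ : H} (hφ : φ ∈ sqDomain ν) (hχ : χ ∈ sqDomain ν) :
    φ + χ ∈ sqDomain ν ∧ A (φ + χ) = A φ + A χ := by
  simpa using hE.add_smul_mem hφ hχ 1

theorem tendsto_sq_sub {φ : H} (hφ : φ ∈ sqDomain ν) :
    Tendsto (fun n => (∫ t, approxId n t ^ 2 ∂(ν φ φ).tv) -
      2 * (⟪A φ, simpleIntegral E (approxId n) φ⟫).re + ‖A φ‖ ^ 2) atTop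
      (𝓝 ((∫ t, t ^ 2 ∂(ν φ φ).tv) - ‖A φ‖ ^ 2)) := by
  have h1 := (Complex.continuous_re.tendsto _).comp (hE.tendsto_of_mem hφ (A φ))
  have h2 : (⟪A φ, A φ⟫).re = ‖A φ‖ ^ 2 := by rw [← inner_self_eq_norm_sq (𝕜 := ℂ)]; rfl
  rw [h2] at h1
  have h3 := ((tendsto_integral_approxId_sq hφ).sub (h1.const_mul 2)).add_const (‖A φ‖ ^ 2)
  rwa [show (∫ t, t ^ 2 ∂(ν φ φ).tv) - 2 * ‖A φ‖ ^ 2 + ‖A φ‖ ^ 2 =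
    (∫ t, t ^ 2 ∂(ν φ φ).tv) - ‖A φ‖ ^ 2 by ring] at h3

theorem norm_sq_le_integral {φ : H} (hφ : φ ∈ sqDomain ν) :
    ‖A φ‖ ^ 2 ≤ ∫ t, t ^ 2 ∂(ν φ φ).tv := by
  rw [← sub_nonneg]
  refine ge_of_tendsto' (hE.tendsto_sq_sub hφ) fun n => ?_
  exact (sq_nonneg _).trans
    (hE.norm_simpleIntegral_sub_sq_le (approxId n) MeasurableSet.univ φ (A φ))

end IsSelfAdjointFirstMoment

end FirstMoment

section Spectral

variable {H : Type*} [NormedAddCommGroup H] [InnerProductSpace ℂ H]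

theorem IsNormalizedPOM.simpleIntegral_mul {Ω : Type*} [MeasurableSpace Ω]
    {E : Set Ω → H →L[ℂ] H} {ν : H → H → ComplexMeasure Ω} (hE : IsNormalizedPOM E ν)
    (hmul : ∀ B₁ B₂ : Set Ω, MeasurableSet B₁ → MeasurableSet B₂ →
      E (B₁ ∩ B₂) = (E B₁).comp (E B₂)) (s u : SimpleFunc Ω ℝ) (φ : H) :
    simpleIntegral E s (simpleIntegral E u φ) = simpleIntegral E (s * u) φ := by
  set g := s.pair u
  have hg : ∀ (F : ℝ × ℝ → ℝ) (v : SimpleFunc Ω ℝ), (∀ t, v t = F (s t, u t)) →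
      simpleIntegral E v = ∑ r ∈ g.range, (F r : ℂ) • E (g ⁻¹' {r}) := by
    intro F v hv
    rw [← hE.simpleIntegral_map g F]
    congr 1
    exact SimpleFunc.ext hv
  rw [hg (fun r => r.1) s fun t => rfl, hg (fun r => r.2) u fun t => rfl,
    hg (fun r => r.1 * r.2) (s * u) fun t => rfl]
  simp only [_root_.sum_apply, _root_.smul_apply, map_sum, map_smul]
  refine Finset.sum_congr rfl fun r hr => ?_
  rw [Finset.sum_eq_single_of_mem r hr]
  · rw [← ContinuousLinearMap.comp_apply,
      ← hmul _ _ (g.measurableSet_fiber r) (g.measurableSet_fiber r), Set.inter_self, smul_smul,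
      Complex.ofReal_mul, mul_comm]
  · intro r' _ hr'
    rw [← ContinuousLinearMap.comp_apply,
      ← hmul _ _ (g.measurableSet_fiber r') (g.measurableSet_fiber r), ← Set.preimage_inter,
      Set.singleton_inter_eq_empty.2 (by simpa using hr'), Set.preimage_empty, hE.empty]
    simp

omit [NormedAddCommGroup H] [InnerProductSpace ℂ H] in
theorem mem_sqDomain_of_cintegrable {ν : H → H → ComplexMeasure ℝ} {φ : H}
    (hφ : (ν φ φ).CIntegrable fun t => (t : ℂ) ^ 2) : φ ∈ sqDomain ν := by
  have := Integrable.norm hφ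
  simpa [sqDomain] using this

namespace IsSelfAdjointFirstMoment

variable {E : Set ℝ → H →L[ℂ] H} {ν : H → H → ComplexMeasure ℝ} {A : H → H}
  (hE : IsSelfAdjointFirstMoment E ν A)
include hE

theorem norm_simpleIntegral_sq
    (hmul : ∀ B₁ B₂ : Set ℝ, MeasurableSet B₁ → MeasurableSet B₂ →
      E (B₁ ∩ B₂) = (E B₁).comp (E B₂)) (s : SimpleFunc ℝ ℝ) (φ : H) :
    ‖simpleIntegral E s φ‖ ^ 2 = ∫ t, s t ^ 2 ∂(ν φ φ).tv := by
  have h : ⟪simpleIntegral E s φ, simpleIntegral E s φ⟫ = (‖simpleIntegral E s φ‖ : ℂ) ^ 2 :=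
    inner_self_eq_norm_sq_to_K _
  rw [hE.isSymmetric_simpleIntegral, hE.simpleIntegral_mul hmul, hE.inner_simpleIntegral_self] at h
  have h2 : ∀ t, (s * s) t = s t ^ 2 := fun t => (sq _).symm
  simp_rw [h2] at h
  exact_mod_cast h.symm

/-- For a spectral measure, matrix elements of `T(s) A` for simple `s`. -/
theorem inner_simpleIntegral_moment
    (hmul : ∀ B₁ B₂ : Set ℝ, MeasurableSet B₁ → MeasurableSet B₂ →
      E (B₁ ∩ B₂) = (E B₁).comp (E B₂)) {φ : H} (hφ : φ ∈ sqDomain ν) (s : SimpleFunc ℝ ℝ)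
    (ψ : H) : Tendsto (fun n => ⟪ψ, simpleIntegral E (s * approxId n) φ⟫) atTop
      (𝓝 ⟪ψ, simpleIntegral E s (A φ)⟫) := by
  rw [← hE.isSymmetric_simpleIntegral]
  refine (hE.tendsto_of_mem hφ _).congr fun n => ?_
  rw [hE.isSymmetric_simpleIntegral, hE.simpleIntegral_mul hmul]

theorem inner_simpleIntegral_moment_eq
    (hmul : ∀ B₁ B₂ : Set ℝ, MeasurableSet B₁ → MeasurableSet B₂ →
      E (B₁ ∩ B₂) = (E B₁).comp (E B₂)) {φ : H} (hφ : φ ∈ sqDomain ν) (s : SimpleFunc ℝ ℝ)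
    (ψ : H) : ⟪ψ, simpleIntegral E s (A φ)⟫ =
      (ν ψ φ).cintegral fun t => ((s t * t : ℝ) : ℂ) := by
  have hi : Integrable (fun t : ℝ => 2 * |s t * t|) (ν ψ φ).tv := by
    obtain ⟨C, hC⟩ := s.exists_forall_norm_le
    have h1 : Integrable (fun t : ℝ => 2 * (C * |t|)) (ν ψ φ).tv := by
      simpa using ((Integrable.norm (hE.cintegrable_of_mem hφ ψ)).const_mul C).const_mul 2
    refine h1.mono' (by fun_prop) (ae_of_all _ fun t => ?_)
    rw [Real.norm_of_nonneg (by positivity), abs_mul]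
    have h2 : |s t| ≤ C := hC t
    gcongr
  refine tendsto_nhds_unique (hE.inner_simpleIntegral_moment hmul hφ s ψ)
    (hE.tendsto_simpleIntegral ψ φ hi (fun n t => ?_)
      fun t => (tendsto_approxId t).const_mul (s t))
  rw [SimpleFunc.mul_apply, abs_mul, abs_mul]
  nlinarith [abs_approxId_le n t, abs_nonneg (s t)]

theorem tendsto_simpleIntegral_moment
    (hmul : ∀ B₁ B₂ : Set ℝ, MeasurableSet B₁ → MeasurableSet B₂ →
      E (B₁ ∩ B₂) = (E B₁).comp (E B₂)) {φ : H}
    (hφ2 : ∀ ψ : H, (ν ψ φ).CIntegrable fun t => (t : ℂ) ^ 2) (hφ : φ ∈ sqDomain ν) (ψ : H) :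
    Tendsto (fun m => ⟪ψ, simpleIntegral E (approxId m) (A φ)⟫) atTop
      (𝓝 ((ν ψ φ).cintegral fun t => (t : ℂ) ^ 2)) := by
  have hi : Integrable (fun t : ℝ => 4 * t ^ 2) (ν ψ φ).tv := by
    have := (hφ2 ψ).norm
    simpa using this.const_mul 4
  simp_rw [hE.inner_simpleIntegral_moment_eq hmul hφ]
  refine ComplexMeasure.tendsto_cintegral _ (fun n => ?_) hi (fun n t => ?_) fun t => ?_
  · exact Complex.measurable_ofReal.comp ((approxId n).measurable.mul measurable_id)
  · rw [Complex.norm_real, Real.norm_eq_abs, abs_mul]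
    nlinarith [abs_approxId_le n t, abs_nonneg t, sq_abs t]
  · have h := (Complex.continuous_ofReal.tendsto _).comp ((tendsto_approxId t).mul_const t)
    rwa [← sq, Complex.ofReal_pow] at h

theorem apply_mem_of_cintegrable_sq [CompleteSpace H]
    (hmul : ∀ B₁ B₂ : Set ℝ, MeasurableSet B₁ → MeasurableSet B₂ →
      E (B₁ ∩ B₂) = (E B₁).comp (E B₂)) {φ : H}
    (hφ2 : ∀ ψ : H, (ν ψ φ).CIntegrable fun t => (t : ℂ) ^ 2) : A φ ∈ sqDomain ν := by
  have hφ := mem_sqDomain_of_cintegrable (hφ2 φ)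
  obtain ⟨C, hC⟩ : ∃ C, ∀ m, ‖simpleIntegral E (approxId m) (A φ)‖ ≤ C := by
    obtain ⟨C, hC⟩ := banach_steinhaus
      (g := fun m => innerSL ℂ (simpleIntegral E (approxId m) (A φ))) fun ψ => by
        obtain ⟨C, hC⟩ :=
          (hE.tendsto_simpleIntegral_moment hmul hφ2 hφ ψ).norm.bddAbove_range
        refine ⟨C, fun m => ?_⟩
        rw [innerSL_apply_apply, ← inner_conj_symm, RCLike.norm_conj]
        exact hC ⟨m, rfl⟩
    exact ⟨C, fun m => by simpa using hC m⟩
  refine (integrable_of_tendsto_of_integral_le (C := C ^ 2) (measurable_id.pow_const 2)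
    (fun m => ?_) (fun m t => sq_nonneg _) (fun t => (tendsto_approxId t).pow 2) fun m => ?_).1
  · exact integrable_approxId_sq m
  · rw [← hE.norm_simpleIntegral_sq hmul]
    exact pow_le_pow_left₀ (norm_nonneg _) (hC m) 2

theorem cintegral_sq_of_mul [CompleteSpace H]
    (hmul : ∀ B₁ B₂ : Set ℝ, MeasurableSet B₁ → MeasurableSet B₂ →
      E (B₁ ∩ B₂) = (E B₁).comp (E B₂)) {φ : H}
    (hφ2 : ∀ ψ : H, (ν ψ φ).CIntegrable fun t => (t : ℂ) ^ 2) (ψ : H) :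
    (ν ψ φ).cintegral (fun t => (t : ℂ) ^ 2) = ⟪ψ, A (A φ)⟫ :=
  tendsto_nhds_unique
    (hE.tendsto_simpleIntegral_moment hmul hφ2 (mem_sqDomain_of_cintegrable (hφ2 φ)) ψ)
    (hE.tendsto_of_mem (hE.apply_mem_of_cintegrable_sq hmul hφ2) ψ)

theorem norm_simpleIntegral_moment_sq
    (hmul : ∀ B₁ B₂ : Set ℝ, MeasurableSet B₁ → MeasurableSet B₂ →
      E (B₁ ∩ B₂) = (E B₁).comp (E B₂)) {φ : H} (hφ : φ ∈ sqDomain ν) (s : SimpleFunc ℝ ℝ) :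
    ‖simpleIntegral E s (A φ)‖ ^ 2 = ∫ t, (s t * t) ^ 2 ∂(ν φ φ).tv := by
  set η := simpleIntegral E s (A φ) with hη
  have h1 : ∀ n, ⟪η, simpleIntegral E (s * approxId n) φ⟫ =
      ((∫ t, s t ^ 2 * (approxId n t * t) ∂(ν φ φ).tv : ℝ) : ℂ) := by
    intro n
    rw [← inner_conj_symm, hη, hE.isSymmetric_simpleIntegral, hE.simpleIntegral_mul hmul,
      hE.inner_simpleIntegral_moment_eq hmul hφ,
      ComplexMeasure.cintegral_of_nonneg _ (hE.diag_nonneg φ), integral_complex_ofReal,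
      Complex.conj_ofReal]
    congr 2
    ext t
    simp only [SimpleFunc.mul_apply]
    ring
  have h2 := hE.inner_simpleIntegral_moment hmul hφ s η
  simp_rw [h1] at h2
  have h3 : ⟪η, η⟫ = ((‖η‖ ^ 2 : ℝ) : ℂ) := by
    rw [inner_self_eq_norm_sq_to_K]
    norm_cast
  rw [← hη, h3] at h2
  refine tendsto_nhds_unique ((Complex.continuous_re.tendsto _).comp h2) ?_
  obtain ⟨C, hC⟩ := s.exists_forall_norm_le
  refine tendsto_integral_of_dominated_convergence (fun t => 2 * C ^ 2 * t ^ 2)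
    (fun n => by fun_prop) (Integrable.const_mul hφ _) (fun n => ae_of_all _ fun t => ?_)
    (ae_of_all _ fun t => ?_)
  · have h4 : s t ^ 2 ≤ C ^ 2 := by
      rw [← sq_abs]
      exact pow_le_pow_left₀ (abs_nonneg _) (hC t) 2
    rw [norm_mul, norm_mul, Real.norm_of_nonneg (sq_nonneg _), Real.norm_eq_abs, Real.norm_eq_abs]
    have h5 : |approxId n t| * |t| ≤ 2 * t ^ 2 := by
      nlinarith [abs_approxId_le n t, abs_nonneg t, sq_abs t]
    calc s t ^ 2 * (|approxId n t| * |t|) ≤ C ^ 2 * (2 * t ^ 2) := by gcongr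
      _ = 2 * C ^ 2 * t ^ 2 := by ring
  · have h := ((tendsto_approxId t).mul_const t).const_mul (s t ^ 2)
    rwa [← sq, ← mul_pow] at h

theorem cintegrable_sq_of_mem
    (hmul : ∀ B₁ B₂ : Set ℝ, MeasurableSet B₁ → MeasurableSet B₂ →
      E (B₁ ∩ B₂) = (E B₁).comp (E B₂)) {φ : H} (hφ : φ ∈ sqDomain ν) (hAφ : A φ ∈ sqDomain ν)
    (ψ : H) : (ν ψ φ).CIntegrable fun t => (t : ℂ) ^ 2 := by
  have h : Integrable (fun t : ℝ => (t ^ 2) ^ 2) (ν φ φ).tv := by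
    refine (integrable_of_tendsto_of_integral_le (F := fun m t => (approxId m t * t) ^ 2)
      (C := 4 * ∫ t, t ^ 2 ∂(ν (A φ) (A φ)).tv) (by fun_prop) (fun m => ?_)
      (fun m t => sq_nonneg _) (fun t => ?_) fun m => ?_).1
    · obtain ⟨C, hC⟩ := (approxId m).exists_forall_norm_le
      refine (Integrable.const_mul hφ (C ^ 2)).mono' (by fun_prop) (ae_of_all _ fun t => ?_)
      rw [Real.norm_of_nonneg (sq_nonneg _), mul_pow]
      refine mul_le_mul_of_nonneg_right ?_ (sq_nonneg t)
      rw [← sq_abs]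
      exact pow_le_pow_left₀ (abs_nonneg _) (hC t) 2
    · simpa [sq] using (((tendsto_approxId t).mul_const t).pow 2)
    · rw [← hE.norm_simpleIntegral_moment_sq hmul hφ, hE.norm_simpleIntegral_sq hmul,
        ← integral_const_mul]
      exact integral_mono (integrable_approxId_sq m)
        (Integrable.const_mul hAφ 4) (approxId_sq_le m)
  simpa using hE.cintegrable_of_sq ψ φ (measurable_id.pow_const 2) h

end IsSelfAdjointFirstMoment

end Spectral

section Core

variable {H : Type*} [NormedAddCommGroup H] [InnerProductSpace ℂ H]

namespace IsSelfAdjointFirstMoment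

variable {E : Set ℝ → H →L[ℂ] H} {ν : H → H → ComplexMeasure ℝ} {A : H → H}

/-- The graph of the selfadjoint first moment operator, as a subspace of the Hilbert sum. -/
def graph (hE : IsSelfAdjointFirstMoment E ν A) : Submodule ℂ (WithLp 2 (H × H)) where
  carrier := {p | p.fst ∈ sqDomain ν ∧ A p.fst = p.snd}
  add_mem' := by
    rintro p q ⟨hp, hp'⟩ ⟨hq, hq'⟩
    have h := hE.add_mem hp hq
    exact ⟨h.1, by rw [WithLp.add_fst, WithLp.add_snd, h.2, hp', hq']⟩
  zero_mem' := hE.zero_mem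
  smul_mem' := by
    rintro c p ⟨hp, hp'⟩
    have h := hE.smul_mem hp c
    exact ⟨h.1, by rw [WithLp.smul_fst, WithLp.smul_snd, h.2, hp']⟩

variable (hE : IsSelfAdjointFirstMoment E ν A)
include hE

theorem mem_graph {p : WithLp 2 (H × H)} :
    p ∈ hE.graph ↔ p.fst ∈ sqDomain ν ∧ A p.fst = p.snd := Iff.rfl

theorem isClosed_graph : IsClosed (hE.graph : Set (WithLp 2 (H × H))) := by
  have h : (hE.graph : Set (WithLp 2 (H × H))) =
      ⋂ χ ∈ sqDomain ν, {p | ⟪p.fst, A χ⟫ = ⟪p.snd, χ⟫} := by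
    ext p
    simp only [SetLike.mem_coe, Set.mem_iInter, hE.mem_graph]
    refine ⟨?_, hE.adj p.fst p.snd⟩
    rintro ⟨h1, h2⟩ χ hχ
    rw [Set.mem_ofPred_eq, ← h2, hE.symm _ h1 _ hχ]
  rw [h]
  refine isClosed_biInter fun χ _ => isClosed_eq ?_ ?_ <;> fun_prop

theorem inner_add_inner_of_mem_orthogonal {q : WithLp 2 (H × H)} (hq : q ∈ hE.graphᗮ) {χ : H}
    (hχ : χ ∈ sqDomain ν) : ⟪q.fst, χ⟫ + ⟪q.snd, A χ⟫ = 0 :=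
  (Submodule.mem_orthogonal' _ _).1 hq (WithLp.toLp 2 (χ, A χ)) ⟨hχ, rfl⟩

theorem exists_add_sq_eq [CompleteSpace H] (v : H) :
    ∃ w ∈ sqDomain ν, A w ∈ sqDomain ν ∧ w + A (A w) = v := by
  have := hE.isClosed_graph.completeSpace_coe
  obtain ⟨g, hg, g', hg', h⟩ :=
    hE.graph.exists_add_mem_mem_orthogonal (WithLp.toLp 2 (v, (0 : H)))
  obtain ⟨h1, h2⟩ := hE.mem_graph.1 hg
  have h3 : v = g.fst + g'.fst := congrArg WithLp.fst h
  have h4 : 0 = g.snd + g'.snd := congrArg WithLp.snd h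
  have h5 := hE.adj (A g.fst) g'.fst fun χ hχ => by
    have h7 : g'.snd = -A g.fst := by rw [h2]; exact eq_neg_of_add_eq_zero_right h4.symm
    have h8 := hE.inner_add_inner_of_mem_orthogonal hg' hχ
    rw [h7, inner_neg_left] at h8
    linear_combination -h8
  exact ⟨g.fst, h1, h5.1, by rw [h5.2, h3]⟩

/-- The domain of `A²` is a core of `A`. -/
theorem exists_seq_tendsto [CompleteSpace H] {φ : H} (hφ : φ ∈ sqDomain ν) : ∃ w : ℕ → H,
    (∀ n, w n ∈ sqDomain ν ∧ A (w n) ∈ sqDomain ν) ∧ Tendsto w atTop (𝓝 φ) ∧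
      Tendsto (fun n => A (w n)) atTop (𝓝 (A φ)) := by
  have := hE.isClosed_graph.completeSpace_coe
  let G₀ : Submodule ℂ (WithLp 2 (H × H)) :=
    { carrier := {p | p ∈ hE.graph ∧ p.snd ∈ sqDomain ν}
      add_mem' := fun hp hq => ⟨Submodule.add_mem _ hp.1 hq.1, (hE.add_mem hp.2 hq.2).1⟩
      zero_mem' := ⟨Submodule.zero_mem _, hE.zero_mem.1⟩
      smul_mem' := fun c _ hp => ⟨Submodule.smul_mem _ c hp.1, (hE.smul_mem hp.2 c).1⟩ }
  have hmem : WithLp.toLp 2 (φ, A φ) ∈ G₀.topologicalClosure := by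
    rw [← Submodule.orthogonal_orthogonal_eq_closure, Submodule.mem_orthogonal]
    intro q hq
    obtain ⟨g, hg, g', hg', rfl⟩ := hE.graph.exists_add_mem_mem_orthogonal q
    obtain ⟨h1, h2⟩ := hE.mem_graph.1 hg
    have h5 : ∀ χ ∈ sqDomain ν,
        ⟪g + g', WithLp.toLp 2 (χ, A χ)⟫ = ⟪g.fst, χ⟫ + ⟪A g.fst, A χ⟫ := by
      intro χ hχ
      have h6 : ⟪g + g', WithLp.toLp 2 (χ, A χ)⟫ =
        ⟪g.fst + g'.fst, χ⟫ + ⟪g.snd + g'.snd, A χ⟫ := rfl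
      have h7 := hE.inner_add_inner_of_mem_orthogonal hg' hχ
      rw [h6, inner_add_left, inner_add_left, h2]
      linear_combination h7
    obtain ⟨w, hw, hAw, hv⟩ := hE.exists_add_sq_eq g.fst
    have h3 : WithLp.toLp 2 (w, A w) ∈ G₀ := ⟨⟨hw, rfl⟩, hAw⟩
    have h4 := (Submodule.mem_orthogonal' _ _).1 hq _ h3
    rw [h5 w hw, hE.symm _ h1 _ hAw, ← inner_add_right, hv, inner_self_eq_zero] at h4
    rw [h5 φ hφ, h4, hE.zero_mem.2, inner_zero_left, inner_zero_left, add_zero]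
  obtain ⟨u, hu, hlim⟩ := mem_closure_iff_seq_limit.1 hmem
  have h1 : Tendsto (fun n => (u n).fst) atTop (𝓝 φ) :=
    ((WithLp.continuous_fst ..).tendsto _).comp hlim
  have h2 : Tendsto (fun n => (u n).snd) atTop (𝓝 (A φ)) :=
    ((WithLp.continuous_snd ..).tendsto _).comp hlim
  exact ⟨fun n => (u n).fst, fun n => ⟨(hu n).1.1, (hu n).1.2 ▸ (hu n).2⟩, h1,
    h2.congr fun n => (hu n).1.2.symm⟩

theorem integral_sq_eq_of_core [CompleteSpace H]
    (h : ∀ φ ∈ sqDomain ν, A φ ∈ sqDomain ν → ∫ t, t ^ 2 ∂(ν φ φ).tv = ‖A φ‖ ^ 2)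
    {φ : H} (hφ : φ ∈ sqDomain ν) : ∫ t, t ^ 2 ∂(ν φ φ).tv = ‖A φ‖ ^ 2 := by
  refine le_antisymm ?_ (hE.norm_sq_le_integral hφ)
  obtain ⟨w, hw, hlim, hlimA⟩ := hE.exists_seq_tendsto hφ
  have key : ∀ s : SimpleFunc ℝ ℝ, (∀ t, 0 ≤ s t ∧ s t ≤ t ^ 2) →
      ∫ t, s t ∂(ν φ φ).tv ≤ ‖A φ‖ ^ 2 := by
    intro s hs
    have h1 : ∀ χ, (⟪χ, simpleIntegral E s χ⟫).re = ∫ t, s t ∂(ν χ χ).tv := fun χ => by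
      rw [hE.inner_simpleIntegral_self, Complex.ofReal_re]
    have h2 : Tendsto (fun n => (⟪w n, simpleIntegral E s (w n)⟫).re) atTop
        (𝓝 (⟪φ, simpleIntegral E s φ⟫).re) :=
      (Complex.continuous_re.tendsto _).comp
        (hlim.inner (((simpleIntegral E s).continuous.tendsto _).comp hlim))
    rw [← h1]
    refine le_of_tendsto_of_tendsto' h2 (hlimA.norm.pow 2) fun n => ?_
    rw [h1, ← h _ (hw n).1 (hw n).2]
    exact integral_mono (SimpleFunc.integrable_of_isFiniteMeasure s) (hw n).1 fun t => (hs t).2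
  set F : ℝ → ℝ≥0∞ := fun t => ENNReal.ofReal (t ^ 2) with hF
  have hFm : Measurable F := by fun_prop
  have hle : ∀ n t, SimpleFunc.eapprox F n t ≤ F t := fun n t => by
    rw [← SimpleFunc.iSup_eapprox_apply hFm t]
    exact le_iSup (fun k => SimpleFunc.eapprox F k t) n
  have hFr : ∀ t, (F t).toReal = t ^ 2 := fun t => ENNReal.toReal_ofReal (sq_nonneg t)
  refine (integrable_of_tendsto_of_integral_le
    (F := fun n t => (SimpleFunc.eapprox F n).map ENNReal.toReal t) (by fun_prop)
    (fun n => SimpleFunc.integrable_of_isFiniteMeasure _) (fun n t => ENNReal.toReal_nonneg)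
    (fun t => ?_) fun n => key _ fun t => ⟨ENNReal.toReal_nonneg, ?_⟩).2
  · rw [← hFr t]
    exact (ENNReal.tendsto_toReal ENNReal.ofReal_ne_top).comp (SimpleFunc.tendsto_eapprox hFm t)
  · rw [← hFr t]
    exact ENNReal.toReal_mono ENNReal.ofReal_ne_top (hle n t)

end IsSelfAdjointFirstMoment

end Core

section Projections

variable {Ω : Type*} [MeasurableSpace Ω]
  {H : Type*} [NormedAddCommGroup H] [InnerProductSpace ℂ H]

namespace IsNormalizedPOM

variable {E : Set Ω → H →L[ℂ] H} {ν : H → H → ComplexMeasure Ω} (hE : IsNormalizedPOM E ν)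
include hE

theorem add_of_disjoint {B C : Set Ω} (hB : MeasurableSet B) (hC : MeasurableSet C)
    (hBC : Disjoint B C) : E (B ∪ C) = E B + E C := by
  refine (hE.ext_of_inner (hB.union hC) fun φ => ?_).symm
  rw [measureReal_union hBC hC, Complex.ofReal_add, hE.tv_real φ hB, hE.tv_real φ hC,
    _root_.add_apply, inner_add_right]

theorem compl {B : Set Ω} (hB : MeasurableSet B) : E Bᶜ = 1 - E B := by
  rw [← hE.one, ← Set.union_compl_self B, hE.add_of_disjoint hB hB.compl disjoint_compl_right,
    add_sub_cancel_left]

theorem norm_apply_sq_le {B : Set Ω} (hB : MeasurableSet B) (φ : H) :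
    ‖E B φ‖ ^ 2 ≤ (⟪φ, E B φ⟫).re := by
  have h := IsPositive.norm_sum_sq_le Finset.univ (fun b : Bool => if b then E B else E Bᶜ)
    (fun b _ => by cases b; exacts [hE.pos _ hB.compl, hE.pos _ hB])
    (by simp [hE.compl hB]) (fun b => if b then φ else 0)
  simpa using h

theorem apply_eq_zero_of_tv {B : Set Ω} (hB : MeasurableSet B) {φ : H}
    (h : (ν φ φ).tv.real B = 0) : E B φ = 0 := by
  have h1 := hE.norm_apply_sq_le hB φ
  rw [← hE.tv_real φ hB, h] at h1
  simpa using h1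

theorem apply_eq_zero_of_subset {B C : Set Ω} (hB : MeasurableSet B) (hC : MeasurableSet C)
    (hCB : C ⊆ B) {φ : H} (h : E B φ = 0) : E C φ = 0 := by
  refine hE.apply_eq_zero_of_tv hC (le_antisymm ?_ measureReal_nonneg)
  refine (measureReal_mono hCB).trans_eq ?_
  have h1 := hE.tv_real φ hB
  rw [h, inner_zero_right] at h1
  exact_mod_cast h1

theorem inter_of_isIdempotentElem {B C : Set Ω} (hB : MeasurableSet B) (hC : MeasurableSet C)
    (h : E B * E B = E B) : E (B ∩ C) = (E B).comp (E C) := by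
  have hp : ∀ φ, E B (E B φ) = E B φ := DFunLike.congr_fun h
  have h1 : E (B ∩ C) * E B = E (B ∩ C) := by
    ext φ
    have h2 := hE.apply_eq_zero_of_subset hB (hB.inter hC) Set.inter_subset_left
      (φ := φ - E B φ) (by rw [map_sub, hp, sub_self])
    rw [map_sub, sub_eq_zero] at h2
    exact h2.symm
  have h3 : E (Bᶜ ∩ C) * E B = 0 := by
    ext φ
    refine hE.apply_eq_zero_of_subset hB.compl (hB.compl.inter hC) Set.inter_subset_left ?_
    rw [hE.compl hB]
    exact sub_eq_zero.2 (hp φ).symm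
  have h4 : E C = E (B ∩ C) + E (Bᶜ ∩ C) := by
    rw [← hE.add_of_disjoint (hB.inter hC) (hB.compl.inter hC)
      (disjoint_compl_right.mono Set.inter_subset_left Set.inter_subset_left),
      ← Set.union_inter_distrib_right, Set.union_compl_self, Set.univ_inter]
  have h5 : E C * E B = E (B ∩ C) := by rw [h4, add_mul, h1, h3, add_zero]
  ext φ
  refine ext_inner_left ℂ fun ψ => ?_
  rw [ContinuousLinearMap.comp_apply, ← (hE.pos B hB).inner_left_eq_inner_right,
    ← (hE.pos C hC).inner_left_eq_inner_right, ← mul_apply_eq_comp, h5,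
    (hE.pos _ (hB.inter hC)).inner_left_eq_inner_right]

theorem isIdempotentElem_iUnion {B : ℕ → Set Ω} (hB : ∀ n, MeasurableSet (B n))
    (hd : Pairwise (Function.onFun Disjoint B)) (h : ∀ n, E (B n) * E (B n) = E (B n)) :
    E (⋃ n, B n) * E (⋃ n, B n) = E (⋃ n, B n) := by
  have hU := MeasurableSet.iUnion hB
  ext φ
  refine ext_inner_left ℂ fun ψ => ?_
  rw [mul_apply_eq_comp]
  have h1 := (ν ψ (E (⋃ n, B n) φ)).m_iUnion hB hd
  have h2 := (ν ψ φ).m_iUnion hB hd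
  rw [hE.apply _ _ _ hU] at h1 h2
  refine h1.unique (h2.congr_fun fun n => ?_)
  rw [hE.apply _ _ _ (hB n), hE.apply _ _ _ (hB n), ← ContinuousLinearMap.comp_apply,
    ← hE.inter_of_isIdempotentElem (hB n) hU (h n), Set.inter_eq_left.2 (Set.subset_iUnion B n)]

end IsNormalizedPOM

theorem IsNormalizedPOM.inter_of_isIdempotentElem_Iic {E : Set ℝ → H →L[ℂ] H}
    {ν : H → H → ComplexMeasure ℝ} (hE : IsNormalizedPOM E ν)
    (h : ∀ a, E (Set.Iic a) * E (Set.Iic a) = E (Set.Iic a)) {B C : Set ℝ}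
    (hB : MeasurableSet B) (hC : MeasurableSet C) : E (B ∩ C) = (E B).comp (E C) := by
  refine hE.inter_of_isIdempotentElem hB hC ?_
  induction B, hB using MeasurableSpace.induction_on_inter (borel_eq_generateFrom_Iic ℝ)
    isPiSystem_Iic with
  | empty => simp [hE.empty]
  | basic B hB =>
    obtain ⟨a, rfl⟩ := hB
    exact h a
  | compl B hB ih =>
    rw [hE.compl hB, mul_sub, sub_mul, sub_mul, ih]
    simp
  | iUnion B hd hB ih => exact hE.isIdempotentElem_iUnion hB hd ih

end Projections

section Commutant

variable {H : Type*} [NormedAddCommGroup H] [InnerProductSpace ℂ H]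

/-- Polarization for a form that vanishes on the diagonal of a subspace. -/
theorem inner_eq_zero_of_diag {D : Submodule ℂ H} {T : D →ₗ[ℂ] H}
    (h : ∀ φ : D, ⟪(φ : H), T φ⟫ = 0) (φ χ : D) : ⟪(φ : H), T χ⟫ = 0 := by
  have h1 := h (φ + χ)
  have h2 := h (φ + Complex.I • χ)
  simp only [map_add, map_smul, Submodule.coe_add, Submodule.coe_smul, inner_add_left,
    inner_add_right, inner_smul_left, inner_smul_right, h, Complex.conj_I] at h1 h2
  have h3 : 2 * ⟪(φ : H), T χ⟫ = 0 := by
    linear_combination h1 - Complex.I * h2 +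
      (⟪(φ : H), T χ⟫ - ⟪(χ : H), T φ⟫) * Complex.I_sq
  simpa using h3

theorem sqrt_mul_one_sub_mul_sqrt [CompleteSpace H] {P : H →L[ℂ] H} (hP : 0 ≤ P) :
    CFC.sqrt P * (1 - P) * CFC.sqrt P = P - P * P := by
  have h := CFC.sqrt_mul_sqrt_self P
  set R := CFC.sqrt P
  rw [← h]
  noncomm_ring

namespace IsSelfAdjointFirstMoment

variable {E : Set ℝ → H →L[ℂ] H} {ν : H → H → ComplexMeasure ℝ} {A : H → H}

/-- The closed star algebra of bounded operators commuting with the first moment operator. -/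
def commutant [CompleteSpace H] (hE : IsSelfAdjointFirstMoment E ν A) :
    NonUnitalStarSubalgebra ℂ (H →L[ℂ] H) where
  carrier := {S | ∀ φ ∈ sqDomain ν, S φ ∈ sqDomain ν ∧ A (S φ) = S (A φ)}
  add_mem' := by
    intro S T hS hT φ hφ
    have h := hE.add_mem (hS φ hφ).1 (hT φ hφ).1
    rw [(hS φ hφ).2, (hT φ hφ).2] at h
    exact h
  zero_mem' := fun _ _ => hE.zero_mem
  smul_mem' := by
    intro c S hS φ hφ
    have h := hE.smul_mem (hS φ hφ).1 c
    rw [(hS φ hφ).2] at h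
    exact h
  mul_mem' := by
    intro S T hS hT φ hφ
    have h := hS _ (hT φ hφ).1
    rw [(hT φ hφ).2] at h
    exact h
  star_mem' := by
    intro S hS φ hφ
    refine hE.adj _ _ fun χ hχ => ?_
    rw [ContinuousLinearMap.star_eq_adjoint, ContinuousLinearMap.adjoint_inner_left,
      ContinuousLinearMap.adjoint_inner_left, ← (hS χ hχ).2, hE.symm φ hφ _ (hS χ hχ).1]

variable (hE : IsSelfAdjointFirstMoment E ν A)
include hE

theorem isClosed_commutant [CompleteSpace H] :
    IsClosed (hE.commutant : Set (H →L[ℂ] H)) := by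
  have h : (hE.commutant : Set (H →L[ℂ] H)) =
      ⋂ φ ∈ sqDomain ν, ⋂ χ ∈ sqDomain ν, {S | ⟪S φ, A χ⟫ = ⟪S (A φ), χ⟫} := by
    ext S
    simp only [Set.mem_iInter]
    constructor
    · intro hS φ hφ χ hχ
      rw [Set.mem_ofPred_eq, ← (hS φ hφ).2, hE.symm _ (hS φ hφ).1 _ hχ]
    · exact fun hS φ hφ => hE.adj _ _ (hS φ hφ)
  rw [h]
  refine isClosed_biInter fun φ _ => isClosed_biInter fun χ _ => isClosed_eq ?_ ?_ <;> fun_prop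

theorem sqrt_mem_commutant [CompleteSpace H] {S : H →L[ℂ] H} (hS0 : 0 ≤ S)
    (hS : S ∈ hE.commutant) : CFC.sqrt S ∈ hE.commutant := by
  have := hE.isClosed_commutant
  rw [CFC.sqrt_eq_real_sqrt S]
  exact cfcₙ_mem (𝕜 := ℝ) _ hS

theorem tendsto_simpleIntegral_piecewise
    (h3 : ∀ φ ∈ sqDomain ν, ∫ t, t ^ 2 ∂(ν φ φ).tv = ‖A φ‖ ^ 2) {φ : H} (hφ : φ ∈ sqDomain ν)
    {B : Set ℝ} (hB : MeasurableSet B) :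
    Tendsto (fun n => simpleIntegral E (approxId n * SimpleFunc.piecewise B hB
      (SimpleFunc.const ℝ 1) (SimpleFunc.const ℝ 0)) φ) atTop (𝓝 (E B (A φ))) := by
  rw [tendsto_iff_norm_sub_tendsto_zero]
  have h1 := hE.tendsto_sq_sub hφ
  rw [h3 φ hφ, sub_self] at h1
  have h2 := squeeze_zero (fun n => sq_nonneg _)
    (fun n => hE.norm_simpleIntegral_sub_sq_le (approxId n) hB φ (A φ)) h1
  have h4 := (Real.continuous_sqrt.tendsto _).comp h2
  rw [Real.sqrt_zero] at h4
  exact h4.congr fun n => Real.sqrt_sq (norm_nonneg _)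

theorem mem_commutant [CompleteSpace H]
    (h3 : ∀ φ ∈ sqDomain ν, ∫ t, t ^ 2 ∂(ν φ φ).tv = ‖A φ‖ ^ 2)
    {B : Set ℝ} (hB : MeasurableSet B) : E B ∈ hE.commutant := by
  refine fun φ hφ => hE.adj _ _ fun χ hχ => ?_
  rw [(hE.pos B hB).inner_left_eq_inner_right]
  refine tendsto_nhds_unique
    (tendsto_const_nhds.inner (hE.tendsto_simpleIntegral_piecewise h3 hχ hB)) ?_
  simp_rw [← hE.isSymmetric_simpleIntegral]
  exact (hE.tendsto_simpleIntegral_piecewise h3 hφ hB).inner tendsto_const_nhds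

theorem inner_apply_moment
    (h3 : ∀ φ ∈ sqDomain ν, ∫ t, t ^ 2 ∂(ν φ φ).tv = ‖A φ‖ ^ 2) {φ : H} (hφ : φ ∈ sqDomain ν)
    {B : Set ℝ} (hB : MeasurableSet B) :
    ⟪φ, E B (A φ)⟫ = ((∫ t in B, t ∂(ν φ φ).tv : ℝ) : ℂ) := by
  have h1 : Tendsto (fun n => ⟪φ, simpleIntegral E (approxId n * SimpleFunc.piecewise B hB
      (SimpleFunc.const ℝ 1) (SimpleFunc.const ℝ 0)) φ⟫) atTop (𝓝 ⟪φ, E B (A φ)⟫) :=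
    tendsto_const_nhds.inner (hE.tendsto_simpleIntegral_piecewise h3 hφ hB)
  have hi : Integrable (fun t : ℝ => 2 * |t|) (ν φ φ).tv := by
    simpa using (Integrable.norm (hE.cintegrable_of_mem hφ φ)).const_mul 2
  have h2 := hE.tendsto_simpleIntegral φ φ (s := fun n => approxId n * SimpleFunc.piecewise B hB
      (SimpleFunc.const ℝ 1) (SimpleFunc.const ℝ 0)) (f := B.indicator fun t => t) hi
    (fun n t => ?_) fun t => ?_
  · rw [tendsto_nhds_unique h1 h2, ComplexMeasure.cintegral_of_nonneg _ (hE.diag_nonneg φ),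
      integral_complex_ofReal, integral_indicator hB]
  · rw [SimpleFunc.mul_apply]
    by_cases ht : t ∈ B
    · simpa [ht] using abs_approxId_le n t
    · simp [ht]
  · by_cases ht : t ∈ B
    · simpa [ht] using tendsto_approxId t
    · simp [ht]

theorem integrable_id {φ : H} (hφ : φ ∈ sqDomain ν) : Integrable (fun t : ℝ => t) (ν φ φ).tv := by
  have h := Integrable.re (hE.cintegrable_of_mem hφ φ)
  exact h

theorem inner_apply_moment_sub
    (h3 : ∀ φ ∈ sqDomain ν, ∫ t, t ^ 2 ∂(ν φ φ).tv = ‖A φ‖ ^ 2) {φ : H} (hφ : φ ∈ sqDomain ν)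
    {B : Set ℝ} (hB : MeasurableSet B) (a : ℝ) :
    ⟪φ, E B (A φ - (a : ℂ) • φ)⟫ = ((∫ t in B, (t - a) ∂(ν φ φ).tv : ℝ) : ℂ) := by
  rw [map_sub, map_smul, inner_sub_right, inner_smul_right, hE.inner_apply_moment h3 hφ hB,
    ← hE.tv_real φ hB, integral_sub (hE.integrable_id hφ).integrableOn (integrable_const a)]
  simp [mul_comm]

/-- Conjugating by a selfadjoint element of the commutant. -/
theorem inner_conj_moment_sub [CompleteSpace H]
    (h3 : ∀ φ ∈ sqDomain ν, ∫ t, t ^ 2 ∂(ν φ φ).tv = ‖A φ‖ ^ 2) {φ : H} (hφ : φ ∈ sqDomain ν)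
    {B : Set ℝ} (hB : MeasurableSet B) (a : ℝ) {S : H →L[ℂ] H} (hS : S ∈ hE.commutant)
    (hSs : IsSelfAdjoint S) :
    ⟪φ, (S * E B * S) (A φ - (a : ℂ) • φ)⟫ =
      ((∫ t in B, (t - a) ∂(ν (S φ) (S φ)).tv : ℝ) : ℂ) := by
  rw [← hE.inner_apply_moment_sub h3 (hS φ hφ).1 hB, (hS φ hφ).2, ← map_smul, ← map_sub]
  exact (ContinuousLinearMap.isSelfAdjoint_iff_isSymmetric.1 hSs φ _).symm

theorem inner_sub_mul_self_moment [CompleteSpace H]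
    (h3 : ∀ φ ∈ sqDomain ν, ∫ t, t ^ 2 ∂(ν φ φ).tv = ‖A φ‖ ^ 2) {φ : H} (hφ : φ ∈ sqDomain ν)
    (a : ℝ) :
    ⟪φ, (E (Set.Iic a) - E (Set.Iic a) * E (Set.Iic a)) (A φ - (a : ℂ) • φ)⟫ = 0 := by
  have hP0 : 0 ≤ E (Set.Iic a) := (ContinuousLinearMap.nonneg_iff_isPositive _).2
    (hE.pos _ measurableSet_Iic)
  have hQ0 : 0 ≤ E (Set.Ioi a) := (ContinuousLinearMap.nonneg_iff_isPositive _).2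
    (hE.pos _ measurableSet_Ioi)
  have hQ : E (Set.Ioi a) = 1 - E (Set.Iic a) := by
    rw [← Set.compl_Iic, hE.compl measurableSet_Iic]
  have h1 := hE.inner_conj_moment_sub h3 hφ (measurableSet_Ioi (a := a)) a
    (hE.sqrt_mem_commutant hP0 (hE.mem_commutant h3 measurableSet_Iic))
    (CFC.sqrt_nonneg _).isSelfAdjoint
  have h2 := hE.inner_conj_moment_sub h3 hφ (measurableSet_Iic (a := a)) a
    (hE.sqrt_mem_commutant hQ0 (hE.mem_commutant h3 measurableSet_Ioi))
    (CFC.sqrt_nonneg _).isSelfAdjoint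
  have h4 : E (Set.Iic a) = 1 - E (Set.Ioi a) := by rw [hQ, sub_sub_cancel]
  have h5 : E (Set.Ioi a) - E (Set.Ioi a) * E (Set.Ioi a) =
      E (Set.Iic a) - E (Set.Iic a) * E (Set.Iic a) := by
    rw [hQ]
    noncomm_ring
  rw [hQ, sqrt_mul_one_sub_mul_sqrt hP0] at h1
  rw [h4, sqrt_mul_one_sub_mul_sqrt hQ0, h5] at h2
  have h6 := setIntegral_nonneg (μ := (ν (CFC.sqrt (E (Set.Iic a)) φ)
    (CFC.sqrt (E (Set.Iic a)) φ)).tv) measurableSet_Ioi fun t (ht : a < t) => (sub_pos.2 ht).le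
  have h7 := setIntegral_nonpos (μ := (ν (CFC.sqrt (E (Set.Ioi a)) φ)
    (CFC.sqrt (E (Set.Ioi a)) φ)).tv) measurableSet_Iic fun t (ht : t ≤ a) => sub_nonpos.2 ht
  rw [h1] at h2 ⊢
  rw [Complex.ofReal_eq_zero]
  exact le_antisymm ((Complex.ofReal_inj.1 h2).trans_le h7) h6

/-- The square integrability domain as a subspace. -/
def domain (hE : IsSelfAdjointFirstMoment E ν A) : Submodule ℂ H where
  carrier := sqDomain ν
  add_mem' h1 h2 := (hE.add_mem h1 h2).1
  zero_mem' := hE.zero_mem.1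
  smul_mem' c _ h := (hE.smul_mem h c).1

theorem sub_mul_self_apply_moment_sub [CompleteSpace H]
    (h3 : ∀ φ ∈ sqDomain ν, ∫ t, t ^ 2 ∂(ν φ φ).tv = ‖A φ‖ ^ 2) {φ : H} (hφ : φ ∈ sqDomain ν)
    (a : ℝ) : (E (Set.Iic a) - E (Set.Iic a) * E (Set.Iic a)) (A φ - (a : ℂ) • φ) = 0 := by
  let T : hE.domain →ₗ[ℂ] H :=
    { toFun := fun χ => (E (Set.Iic a) - E (Set.Iic a) * E (Set.Iic a)) (A χ - (a : ℂ) • χ)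
      map_add' := by
        intro χ η
        rw [← map_add, Submodule.coe_add, (hE.add_mem χ.2 η.2).2, smul_add, add_sub_add_comm]
      map_smul' := by
        intro c χ
        rw [Submodule.coe_smul, (hE.smul_mem χ.2 c).2, smul_comm, ← smul_sub, map_smul,
          RingHom.id_apply] }
  have hd : Dense (hE.domain : Set H) := hE.dense
  exact hd.eq_zero_of_inner_right ℂ fun χ hχ => inner_eq_zero_of_diag (T := T)
    (fun η => hE.inner_sub_mul_self_moment h3 η.2 a) ⟨χ, hχ⟩ ⟨φ, hφ⟩

/-- An eigenvector for the eigenvalue `a` has no mass beyond `a`. -/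
theorem apply_Ioi_eq_zero
    (h3 : ∀ φ ∈ sqDomain ν, ∫ t, t ^ 2 ∂(ν φ φ).tv = ‖A φ‖ ^ 2) {φ : H} (hφ : φ ∈ sqDomain ν)
    {a : ℝ} (ha : A φ = (a : ℂ) • φ) : E (Set.Ioi a) φ = 0 := by
  have h1 := hE.inner_apply_moment_sub h3 hφ (measurableSet_Ioi (a := a)) a
  rw [ha, sub_self, map_zero, inner_zero_right, eq_comm, Complex.ofReal_eq_zero,
    setIntegral_eq_zero_iff_of_nonneg_ae] at h1
  · refine hE.apply_eq_zero_of_tv measurableSet_Ioi ?_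
    have h2 : ∀ᵐ t ∂(ν φ φ).tv, t ∉ Set.Ioi a := by
      filter_upwards [(ae_restrict_iff' measurableSet_Ioi).1 h1] with t ht hta
      exact (sub_pos.2 hta).ne' (ht hta)
    rw [Measure.real, measure_eq_zero_iff_ae_notMem.2 h2, ENNReal.toReal_zero]
  · exact (ae_restrict_iff' measurableSet_Ioi).2
      (ae_of_all _ fun t (ht : a < t) => (sub_pos.2 ht).le)
  · exact ((hE.integrable_id hφ).sub (integrable_const a)).integrableOn

theorem isIdempotentElem_Iic [CompleteSpace H]
    (h3 : ∀ φ ∈ sqDomain ν, ∫ t, t ^ 2 ∂(ν φ φ).tv = ‖A φ‖ ^ 2) (a : ℝ) :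
    E (Set.Iic a) * E (Set.Iic a) = E (Set.Iic a) := by
  have hP := hE.mem_commutant h3 (measurableSet_Iic (a := a))
  have hQ : E (Set.Ioi a) = 1 - E (Set.Iic a) := by
    rw [← Set.compl_Iic, hE.compl measurableSet_Iic]
  set P := E (Set.Iic a) with hPdef
  have hN : P - P * P ∈ hE.commutant := sub_mem hP (mul_mem hP hP)
  have h1 : E (Set.Ioi a) * (P - P * P) = 0 := by
    refine ContinuousLinearMap.coeFn_injective (Continuous.ext_on hE.dense
      (ContinuousLinearMap.continuous _) (ContinuousLinearMap.continuous _) fun φ hφ => ?_)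
    refine hE.apply_Ioi_eq_zero h3 (hN φ hφ).1 ?_
    have h2 := hE.sub_mul_self_apply_moment_sub h3 hφ a
    rw [map_sub, map_smul, sub_eq_zero] at h2
    rw [(hN φ hφ).2, h2]
  have hPs : IsSelfAdjoint P := (hE.pos _ measurableSet_Iic).isSelfAdjoint
  have hNs : star (P - P * P) = P - P * P := by
    rw [star_sub, star_mul, hPs.star_eq]
  have h2 : star (P - P * P) * (P - P * P) = 0 := by
    rw [hNs]
    calc (P - P * P) * (P - P * P) = P * ((1 - P) * (P - P * P)) := by noncomm_ring
      _ = 0 := by rw [← hQ, h1, mul_zero]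
  rw [CStarRing.star_mul_self_eq_zero_iff, sub_eq_zero] at h2
  exact h2.symm

/-- If `∫ t² d⟨φ, E φ⟩ = ‖A φ‖²` on the square integrability domain, then `E` is spectral. -/
theorem inter_of_integral_sq [CompleteSpace H]
    (h3 : ∀ φ ∈ sqDomain ν, ∫ t, t ^ 2 ∂(ν φ φ).tv = ‖A φ‖ ^ 2) {B C : Set ℝ}
    (hB : MeasurableSet B) (hC : MeasurableSet C) : E (B ∩ C) = (E B).comp (E C) :=
  hE.toIsNormalizedPOM.inter_of_isIdempotentElem_Iic (hE.isIdempotentElem_Iic h3) hB hC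

end IsSelfAdjointFirstMoment

end Commutant
section Square

variable {H : Type*} [NormedAddCommGroup H] [InnerProductSpace ℂ H] {E : Set ℝ → H →L[ℂ] H}
  {ν : H → H → ComplexMeasure ℝ} {A : H → H}

/-- If `L(x²,E)` extends the square of `A`, then `∫ t² d⟨φ, E φ⟩ = ‖A φ‖²` on the square
integrability domain. -/
theorem IsSelfAdjointFirstMoment.integral_sq_eq_of_cintegral_sq [CompleteSpace H]
    (hE : IsSelfAdjointFirstMoment E ν A)
    (h : ∀ φ ∈ sqDomain ν, A φ ∈ sqDomain ν →
      (ν φ φ).cintegral (fun t => (t : ℂ) ^ 2) = ⟪φ, A (A φ)⟫)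
    {φ : H} (hφ : φ ∈ sqDomain ν) : ∫ t, t ^ 2 ∂(ν φ φ).tv = ‖A φ‖ ^ 2 := by
  refine hE.integral_sq_eq_of_core (fun χ hχ hAχ => ?_) hφ
  have h1 := h χ hχ hAχ
  rw [ComplexMeasure.cintegral_of_nonneg _ (hE.diag_nonneg χ), ← hE.symm χ hχ _ hAχ,
    inner_self_eq_norm_sq_to_K] at h1
  simp_rw [← Complex.ofReal_pow] at h1
  rw [integral_complex_ofReal] at h1
  exact Complex.ofReal_injective (h1.trans (Complex.ofReal_pow _ _).symm)

end Square

/-- Let `E : ℬ(ℝ) → L(H)` be a normalized positive operator measure such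
that the restriction of `L(x,E)` to `D²(x,E)` is selfadjoint. Then the following are
equivalent: (i) `E` is a spectral measure; (ii) `L(x²,E) = L(x,E)²` (equal domains and
values); (iii) `∫ x² dE_{φ,φ} = ‖L(x,E)φ‖²` for all `φ ∈ D²(x,E)`. Here `A` denotes the
operator `L(x,E)`. -/
theorem stmt19 {H : Type*} [NormedAddCommGroup H] [InnerProductSpace ℂ H] [CompleteSpace H]
    (E : Set ℝ → H →L[ℂ] H) (hEpos : ∀ B : Set ℝ, MeasurableSet B → (E B).IsPositive)
    (hEone : E Set.univ = 1)
    (ν : H → H → MeasureTheory.ComplexMeasure ℝ)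
    (hν : ∀ (ψ φ : H) (B : Set ℝ), MeasurableSet B → ν ψ φ B = ⟪ψ, E B φ⟫)
    (A : H → H)
    (hA : ∀ φ : H, (∀ ψ : H, (ν ψ φ).CIntegrable fun t => (t : ℂ)) →
      ∀ ψ : H, ⟪ψ, A φ⟫ = (ν ψ φ).cintegral fun t => (t : ℂ))
    -- the restriction of `L(x,E)` to `D²(x,E)` is selfadjoint:
    (hdense : Dense {φ : H | Integrable (fun t : ℝ => t ^ 2) (ν φ φ).tv})
    (hsym : ∀ φ ∈ {φ : H | Integrable (fun t : ℝ => t ^ 2) (ν φ φ).tv},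
      ∀ φ' ∈ {φ : H | Integrable (fun t : ℝ => t ^ 2) (ν φ φ).tv},
        ⟪A φ, φ'⟫ = ⟪φ, A φ'⟫)
    (hadj : ∀ ψ χ : H,
      (∀ φ ∈ {φ : H | Integrable (fun t : ℝ => t ^ 2) (ν φ φ).tv}, ⟪ψ, A φ⟫ = ⟪χ, φ⟫) →
      Integrable (fun t : ℝ => t ^ 2) (ν ψ ψ).tv ∧ A ψ = χ) :
    -- (i) ↔ (ii)
    ((∀ B₁ B₂ : Set ℝ, MeasurableSet B₁ → MeasurableSet B₂ →
        E (B₁ ∩ B₂) = (E B₁).comp (E B₂)) ↔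
      (({φ : H | ∀ ψ : H, (ν ψ φ).CIntegrable fun t => (t : ℂ) ^ 2} =
          {φ : H | (∀ ψ : H, (ν ψ φ).CIntegrable fun t => (t : ℂ)) ∧
            ∀ ψ : H, (ν ψ (A φ)).CIntegrable fun t => (t : ℂ)}) ∧
        ∀ φ ∈ {φ : H | ∀ ψ : H, (ν ψ φ).CIntegrable fun t => (t : ℂ) ^ 2},
          ∀ ψ : H, (ν ψ φ).cintegral (fun t => (t : ℂ) ^ 2) = ⟪ψ, A (A φ)⟫)) ∧
    -- (ii) ↔ (iii)
    ((({φ : H | ∀ ψ : H, (ν ψ φ).CIntegrable fun t => (t : ℂ) ^ 2} =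
          {φ : H | (∀ ψ : H, (ν ψ φ).CIntegrable fun t => (t : ℂ)) ∧
            ∀ ψ : H, (ν ψ (A φ)).CIntegrable fun t => (t : ℂ)}) ∧
        ∀ φ ∈ {φ : H | ∀ ψ : H, (ν ψ φ).CIntegrable fun t => (t : ℂ) ^ 2},
          ∀ ψ : H, (ν ψ φ).cintegral (fun t => (t : ℂ) ^ 2) = ⟪ψ, A (A φ)⟫) ↔
      (∀ φ : H, Integrable (fun t : ℝ => t ^ 2) (ν φ φ).tv →
        ∫ t : ℝ, t ^ 2 ∂(ν φ φ).tv = ‖A φ‖ ^ 2)) := by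
  have hE : IsSelfAdjointFirstMoment E ν A :=
    { pos := hEpos, one := hEone, apply := hν, inner_moment := hA, dense := hdense, symm := hsym,
      adj := hadj }
  have h31 (h3 : ∀ φ : H, Integrable (fun t : ℝ => t ^ 2) (ν φ φ).tv →
        ∫ t : ℝ, t ^ 2 ∂(ν φ φ).tv = ‖A φ‖ ^ 2) : ∀ B₁ B₂ : Set ℝ, MeasurableSet B₁ →
      MeasurableSet B₂ → E (B₁ ∩ B₂) = (E B₁).comp (E B₂) :=
    fun _ _ hB₁ hB₂ => hE.inter_of_integral_sq h3 hB₁ hB₂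
  have h12 (h1 : ∀ B₁ B₂ : Set ℝ, MeasurableSet B₁ → MeasurableSet B₂ →
        E (B₁ ∩ B₂) = (E B₁).comp (E B₂)) :
      ({φ : H | ∀ ψ : H, (ν ψ φ).CIntegrable fun t => (t : ℂ) ^ 2} =
          {φ : H | (∀ ψ : H, (ν ψ φ).CIntegrable fun t => (t : ℂ)) ∧
            ∀ ψ : H, (ν ψ (A φ)).CIntegrable fun t => (t : ℂ)}) ∧
        ∀ φ ∈ {φ : H | ∀ ψ : H, (ν ψ φ).CIntegrable fun t => (t : ℂ) ^ 2},
          ∀ ψ : H, (ν ψ φ).cintegral (fun t => (t : ℂ) ^ 2) = ⟪ψ, A (A φ)⟫ := by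
    refine ⟨Set.ext fun φ => ?_, fun φ hφ => hE.cintegral_sq_of_mul h1 hφ⟩
    simp only [Set.mem_ofPred_eq, hE.cintegrable_iff]
    exact ⟨fun h => ⟨mem_sqDomain_of_cintegrable (h φ), hE.apply_mem_of_cintegrable_sq h1 h⟩,
      fun h => hE.cintegrable_sq_of_mem h1 h.1 h.2⟩
  have h23 (h2 : ({φ : H | ∀ ψ : H, (ν ψ φ).CIntegrable fun t => (t : ℂ) ^ 2} =
          {φ : H | (∀ ψ : H, (ν ψ φ).CIntegrable fun t => (t : ℂ)) ∧
            ∀ ψ : H, (ν ψ (A φ)).CIntegrable fun t => (t : ℂ)}) ∧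
        ∀ φ ∈ {φ : H | ∀ ψ : H, (ν ψ φ).CIntegrable fun t => (t : ℂ) ^ 2},
          ∀ ψ : H, (ν ψ φ).cintegral (fun t => (t : ℂ) ^ 2) = ⟪ψ, A (A φ)⟫) (φ : H)
      (hφ : Integrable (fun t : ℝ => t ^ 2) (ν φ φ).tv) :
      ∫ t : ℝ, t ^ 2 ∂(ν φ φ).tv = ‖A φ‖ ^ 2 := by
    refine hE.integral_sq_eq_of_cintegral_sq (fun χ hχ hAχ => h2.2 χ ?_ χ) hφ
    rw [h2.1]
    exact ⟨hE.cintegrable_of_mem hχ, hE.cintegrable_of_mem hAχ⟩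
  exact ⟨⟨h12, fun h => h31 (h23 h)⟩, ⟨h23, fun h => h12 (h31 h)⟩⟩
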